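/- arXiv:1507.01104 — 5 statements merged into one kernel-verified Lean document; each statement's English description precedes it below -/
import Mathlib

section
/- Let ν > -1 and let γ_{ν,1} be the smallest positive zero of 𝒲_ν. Then the function x ↦ 𝒲_ν(x) is strictly increasing on (-γ_{ν,1}, 0] and strictly decreasing on [0, γ_{ν,1}). -/
open Real Set

/-- Bessel function of the first kind `J_ν(x)` (series definition, intended for `x > 0`). -/
noncomputable def besselJ (ν x : ℝ) : ℝ :=
  ∑' n : ℕ, (-1 : ℝ) ^ n * (x / 2) ^ (ν + 2 * (n : ℝ)) /
    ((n.factorial : ℝ) * Real.Gamma (ν + n + 1))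

/-- Modified Bessel function of the first kind `I_ν(x)` (series definition, for `x > 0`). -/
noncomputable def besselI (ν x : ℝ) : ℝ :=
  ∑' n : ℕ, (x / 2) ^ (ν + 2 * (n : ℝ)) /
    ((n.factorial : ℝ) * Real.Gamma (ν + n + 1))

/-- The cross-product `W_ν(x) = J_{ν+1}(x) I_ν(x) + J_ν(x) I_{ν+1}(x)`. -/
noncomputable def crossW (ν x : ℝ) : ℝ :=
  besselJ (ν + 1) x * besselI ν x + besselJ ν x * besselI (ν + 1) x

/-- The normalized cross-product `𝒲_ν`, an even entire function of `x`. -/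
noncomputable def Wcal (ν x : ℝ) : ℝ :=
  ∑' n : ℕ, (-1 : ℝ) ^ n * (Real.Gamma (ν + 1) * Real.Gamma (ν + 2)) * x ^ (4 * n) /
    ((2 : ℝ) ^ (4 * n) * (n.factorial : ℝ) * Real.Gamma (ν + n + 1) * Real.Gamma (ν + 2 * n + 2))

/-- The normalized Dini function `𝒟_ν`. -/
noncomputable def Dcal (ν x : ℝ) : ℝ :=
  ∑' n : ℕ, (-1 : ℝ) ^ n * (2 * (n : ℝ) + 1) * Real.Gamma (ν + 1) * x ^ (2 * n) /
    ((2 : ℝ) ^ (2 * n) * (n.factorial : ℝ) * Real.Gamma (ν + n + 1))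

/-- The normalized modified Dini function `λ_ν`. -/
noncomputable def lamDini (ν x : ℝ) : ℝ :=
  ∑' n : ℕ, (2 * (n : ℝ) + 1) * Real.Gamma (ν + 1) * x ^ (2 * n) /
    ((2 : ℝ) ^ (2 * n) * (n.factorial : ℝ) * Real.Gamma (ν + n + 1))

/-- The normalized Bessel function `𝒥_ν`. -/
noncomputable def Jcal (ν x : ℝ) : ℝ :=
  ∑' n : ℕ, (-1 : ℝ) ^ n * Real.Gamma (ν + 1) * x ^ (2 * n) /
    ((2 : ℝ) ^ (2 * n) * (n.factorial : ℝ) * Real.Gamma (ν + n + 1))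

/-- The normalized modified Bessel function `𝓘_ν`. -/
noncomputable def Ical (ν x : ℝ) : ℝ :=
  ∑' n : ℕ, Real.Gamma (ν + 1) * x ^ (2 * n) /
    ((2 : ℝ) ^ (2 * n) * (n.factorial : ℝ) * Real.Gamma (ν + n + 1))

/-- A function is absolutely monotonic on a set if it is infinitely differentiable there and
all of its (iterated) derivatives are nonnegative there. -/
def AbsolutelyMonotonicOn (f : ℝ → ℝ) (s : Set ℝ) : Prop :=
  ContDiffOn ℝ (⊤ : ℕ∞) f s ∧ ∀ (k : ℕ), ∀ x ∈ s, 0 ≤ iteratedDerivWithin k f s x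

/-- Entire power series coefficients. -/
def EntCoef (e : ℕ → ℝ) : Prop := ∀ r : ℝ, Summable fun n : ℕ => e n * r ^ n

lemma EntCoef.mul_lin {e : ℕ → ℝ} (he : EntCoef e) (b : ℝ) :
    EntCoef (fun n => e n * ((n : ℝ) + b)) := by
  intro r
  have h := ((he (2 * r)).norm).mul_left (1 + |b|)
  refine Summable.of_norm_bounded h ?_
  intro n
  have h2 : (n : ℝ) ≤ 2 ^ n := by exact_mod_cast (Nat.lt_two_pow_self (n := n)).le
  have h1 : (1 : ℝ) ≤ 2 ^ n := one_le_pow₀ (by norm_num)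
  have h3 : |(n : ℝ) + b| ≤ (1 + |b|) * 2 ^ n := by
    calc |(n : ℝ) + b| ≤ |(n : ℝ)| + |b| := abs_add_le _ _
      _ = n + |b| := by rw [abs_of_nonneg (Nat.cast_nonneg n)]
      _ ≤ (1 + |b|) * 2 ^ n := by nlinarith [abs_nonneg b]
  simp only [Real.norm_eq_abs, abs_mul, abs_pow, mul_pow, abs_two]
  have h4 : 0 ≤ |e n| * |r| ^ n := by positivity
  calc |e n| * |(n : ℝ) + b| * |r| ^ n = (|e n| * |r| ^ n) * |(n : ℝ) + b| := by ring
    _ ≤ (|e n| * |r| ^ n) * ((1 + |b|) * 2 ^ n) := mul_le_mul_of_nonneg_left h3 h4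
    _ = _ := by ring

lemma EntCoef.shift {e : ℕ → ℝ} (he : EntCoef e) :
    EntCoef (fun n => e (n + 1) * ((n : ℝ) + 1)) := by
  intro r
  by_cases hr : r = 0
  · subst hr
    refine summable_of_ne_finset_zero (s := {0}) ?_
    intro n hn
    have : n ≠ 0 := by simpa using hn
    simp [this]
  · have h := (summable_nat_add_iff 1).2 ((he.mul_lin 0) r)
    refine (h.mul_left r⁻¹).congr ?_
    intro n
    push_cast
    field_simp
    ring

lemma EntCoef.hasDerivAt {e : ℕ → ℝ} (he : EntCoef e) (t : ℝ) :
    HasDerivAt (fun y : ℝ => ∑' n : ℕ, e n * y ^ n)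
      (∑' n : ℕ, e (n + 1) * ((n : ℝ) + 1) * t ^ n) t := by
  set R : ℝ := |t| + 1 with hR
  have hRpos : 0 < R := by positivity
  have hsum : Summable fun n : ℕ => |e n| * ((n : ℝ) * R ^ (n - 1)) := by
    refine (summable_nat_add_iff 1).1 ?_
    refine ((he.shift R).abs).congr ?_
    intro n
    have : (0 : ℝ) ≤ (n : ℝ) + 1 := by positivity
    simp only [abs_mul, abs_pow, abs_of_pos hRpos, abs_of_nonneg this]
    push_cast
    simp [mul_assoc]
  have key := hasDerivAt_tsum_of_isPreconnected (𝕜 := ℝ) (F := ℝ)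
    (g := fun (n : ℕ) (y : ℝ) => e n * y ^ n)
    (g' := fun (n : ℕ) (y : ℝ) => e n * ((n : ℝ) * y ^ (n - 1)))
    (t := Metric.ball (0 : ℝ) R) (y₀ := 0) (y := t) hsum Metric.isOpen_ball
    (convex_ball (0 : ℝ) R).isPreconnected
    (fun n y _ => (hasDerivAt_pow n y).const_mul (e n))
    (fun n y hy => by
      have hy' : |y| ≤ R := by
        have := Metric.mem_ball.1 hy
        rw [Real.dist_eq, sub_zero] at this
        exact this.le
      simp only [Real.norm_eq_abs, abs_mul, abs_pow, Nat.abs_cast]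
      gcongr)
    (by simpa using hRpos) (he 0)
    (by rw [Metric.mem_ball, Real.dist_eq, sub_zero]; linarith)
  have hs : Summable fun n : ℕ => e n * ((n : ℝ) * t ^ (n - 1)) := by
    refine (summable_nat_add_iff 1).1 ?_
    refine (he.shift t).congr ?_
    intro n
    push_cast
    simp [mul_assoc]
  have hval : ∑' n : ℕ, e n * ((n : ℝ) * t ^ (n - 1))
      = ∑' n : ℕ, e (n + 1) * ((n : ℝ) + 1) * t ^ n := by
    rw [hs.tsum_eq_zero_add]
    simp [mul_assoc]
  rw [← hval]
  exact key

lemma EntCoef.neg_step {e : ℕ → ℝ} (he : EntCoef e) {b T : ℝ} (hb : 0 < b)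
    (h : ∀ t ∈ Ioo 0 T, ∑' n : ℕ, e n * ((n : ℝ) + b) * t ^ n < 0) :
    ∀ t ∈ Ioo 0 T, ∑' n : ℕ, e n * t ^ n < 0 := by
  intro t ht
  have hcont : Continuous fun y : ℝ => ∑' n : ℕ, e n * y ^ n :=
    continuous_iff_continuousAt.2 fun y => (he.hasDerivAt y).continuousAt
  have hanti : StrictAntiOn (fun y : ℝ => y ^ b * ∑' n : ℕ, e n * y ^ n) (Icc 0 t) := by
    refine strictAntiOn_of_deriv_neg (convex_Icc 0 t) ?_ ?_
    · exact ((Real.continuous_rpow_const hb.le).mul hcont).continuousOn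
    · intro y hy
      rw [interior_Icc] at hy
      have hy0 : 0 < y := hy.1
      have hd := (Real.hasDerivAt_rpow_const (x := y) (p := b) (Or.inl hy0.ne')).mul
        (he.hasDerivAt y)
      have hd' : deriv (fun y : ℝ => y ^ b * ∑' n : ℕ, e n * y ^ n) y = _ := hd.deriv
      rw [hd']
      have h1 := h y ⟨hy0, hy.2.trans ht.2⟩
      have h2 : ∑' n : ℕ, e n * ((n : ℝ) + b) * y ^ n
          = y * (∑' n : ℕ, e (n + 1) * ((n : ℝ) + 1) * y ^ n) + b * ∑' n : ℕ, e n * y ^ n := by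
        have hs := he.mul_lin 0 y
        have e1 : ∑' n : ℕ, e n * ((n : ℝ) + 0) * y ^ n
            = y * (∑' n : ℕ, e (n + 1) * ((n : ℝ) + 1) * y ^ n) := by
          rw [hs.tsum_eq_zero_add, ← tsum_mul_left]
          simp only [Nat.cast_zero, add_zero, mul_zero, zero_mul, zero_add]
          refine tsum_congr fun n => ?_
          push_cast
          ring
        rw [← e1, ← tsum_mul_left, ← hs.tsum_add ((he y).mul_left b)]
        refine tsum_congr fun n => ?_
        ring
      have h3 : y ^ b = y ^ (b - 1) * y := by
        rw [← Real.rpow_add_one hy0.ne']; simp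
      have h4 : 0 < y ^ (b - 1) := Real.rpow_pos_of_pos hy0 _
      rw [h3]
      rw [h2] at h1
      have := mul_neg_of_pos_of_neg h4 h1
      linarith
  have := hanti (left_mem_Icc.2 ht.1.le) (right_mem_Icc.2 ht.1.le) ht.1
  simp only [Real.zero_rpow hb.ne', zero_mul] at this
  have hp : 0 < t ^ b := Real.rpow_pos_of_pos ht.1 _
  by_contra hc
  push Not at hc
  have := mul_nonneg hp.le hc
  linarith

/-- Coefficients of `𝒲_ν` in the variable `(x/2)^4`. -/
noncomputable def wc (ν : ℝ) (n : ℕ) : ℝ :=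
  (-1 : ℝ) ^ n * (Real.Gamma (ν + 1) * Real.Gamma (ν + 2)) /
    ((n.factorial : ℝ) * Real.Gamma (ν + n + 1) * Real.Gamma (ν + 2 * n + 2))

lemma wc_zero {ν : ℝ} (hν : -1 < ν) : wc ν 0 = 1 := by
  have h1 : Real.Gamma (ν + 1) ≠ 0 := (Real.Gamma_pos_of_pos (by linarith)).ne'
  have h2 : Real.Gamma (ν + 2) ≠ 0 := (Real.Gamma_pos_of_pos (by linarith)).ne'
  simp [wc, h1, h2]

lemma wc_succ {ν : ℝ} (hν : -1 < ν) (n : ℕ) :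
    wc ν (n + 1) * ((n : ℝ) + 1) * ((n : ℝ) + (ν + 1)) * ((n : ℝ) + (ν + 2) / 2)
      * ((n : ℝ) + (ν + 3) / 2) = - wc ν n / 4 := by
  have hn : (0 : ℝ) ≤ n := Nat.cast_nonneg n
  have a1 : 0 < ν + n + 1 := by linarith
  have a2 : 0 < ν + 2 * n + 2 := by linarith
  have a3 : 0 < ν + 2 * n + 3 := by linarith
  have g1 : Real.Gamma (ν + (n + 1 : ℕ) + 1) = (ν + n + 1) * Real.Gamma (ν + n + 1) := by
    rw [← Real.Gamma_add_one a1.ne']; congr 1; push_cast; ring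
  have g2 : Real.Gamma (ν + 2 * (n + 1 : ℕ) + 2)
      = (ν + 2 * n + 3) * ((ν + 2 * n + 2) * Real.Gamma (ν + 2 * n + 2)) := by
    rw [← Real.Gamma_add_one a2.ne', show ν + 2 * (n : ℝ) + 2 + 1 = ν + 2 * n + 3 by ring,
      ← Real.Gamma_add_one a3.ne']
    congr 1; push_cast; ring
  have p1 := (Real.Gamma_pos_of_pos a1).ne'
  have p2 := (Real.Gamma_pos_of_pos a2).ne'
  have p3 : (n.factorial : ℝ) ≠ 0 := by positivity
  have p4 : (n : ℝ) + 1 ≠ 0 := by positivity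
  unfold wc
  rw [g1, g2, Nat.factorial_succ, pow_succ]
  push_cast
  generalize Real.Gamma (ν + n + 1) = G1 at *
  generalize Real.Gamma (ν + 2 * n + 2) = G2 at *
  have a1' := a1.ne'
  have a2' := a2.ne'
  have a3' := a3.ne'
  field_simp
  ring

lemma wc_bound {ν : ℝ} (hν : -1 < ν) (n : ℕ) :
    |wc ν n| ≤ ((ν + 1) * (ν + 2) * (ν + 3))⁻¹ ^ n / n.factorial := by
  set K := (ν + 1) * (ν + 2) * (ν + 3) with hK
  have b1 : 0 < ν + 1 := by linarith
  have b2 : 0 < ν + 2 := by linarith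
  have b3 : 0 < ν + 3 := by linarith
  have hKpos : 0 < K := by positivity
  induction n with
  | zero => simp [wc_zero hν]
  | succ n ih =>
    have hn : (0 : ℝ) ≤ n := Nat.cast_nonneg n
    have h := wc_succ hν n
    set Q := ((n : ℝ) + (ν + 1)) * (2 * (n : ℝ) + (ν + 2)) * (2 * (n : ℝ) + (ν + 3)) with hQ
    have hKQ : K ≤ Q := by
      rw [hK, hQ]
      have q1 : ν + 1 ≤ (n : ℝ) + (ν + 1) := by linarith
      have q2 : ν + 2 ≤ 2 * (n : ℝ) + (ν + 2) := by linarith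
      have q3 : ν + 3 ≤ 2 * (n : ℝ) + (ν + 3) := by linarith
      exact mul_le_mul (mul_le_mul q1 q2 b2.le (by linarith)) q3 b3.le
        (mul_nonneg (by linarith) (by linarith))
    have h' : wc ν (n + 1) * (((n : ℝ) + 1) * Q) = - wc ν n := by
      rw [hQ]; linarith
    have hQpos : 0 < Q := hKpos.trans_le hKQ
    have h2 : |wc ν (n + 1)| * (((n : ℝ) + 1) * Q) = |wc ν n| := by
      have := congrArg abs h'
      rwa [abs_mul, abs_neg, abs_of_pos (by positivity : 0 < ((n : ℝ) + 1) * Q)] at this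
    have h3 : |wc ν (n + 1)| * (((n : ℝ) + 1) * K) ≤ K⁻¹ ^ n / n.factorial := by
      refine le_trans ?_ ih
      rw [← h2]
      gcongr
    have h4 : K⁻¹ ^ (n + 1) / ((n + 1).factorial : ℝ)
        = (K⁻¹ ^ n / n.factorial) / (((n : ℝ) + 1) * K) := by
      rw [Nat.factorial_succ, pow_succ]
      push_cast
      have : (n : ℝ) + 1 ≠ 0 := by positivity
      field_simp
    rw [h4, le_div_iff₀ (by positivity)]
    exact h3

lemma wc_ent {ν : ℝ} (hν : -1 < ν) : EntCoef (wc ν) := by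
  intro r
  refine Summable.of_norm_bounded
    (Real.summable_pow_div_factorial (((ν + 1) * (ν + 2) * (ν + 3))⁻¹ * |r|)) ?_
  intro n
  rw [Real.norm_eq_abs, abs_mul, abs_pow, mul_pow, mul_div_right_comm]
  exact mul_le_mul_of_nonneg_right (wc_bound hν n) (by positivity)

lemma Wcal_eq (ν x : ℝ) : Wcal ν x = ∑' n : ℕ, wc ν n * ((x / 2) ^ 4) ^ n := by
  unfold Wcal wc
  refine tsum_congr fun n => ?_
  rw [← pow_mul, div_pow, div_mul_div_comm]
  congr 1
  ring

lemma wF_anti {ν : ℝ} (hν : -1 < ν) {T : ℝ}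
    (hpos : ∀ t ∈ Ioo 0 T, 0 < ∑' n : ℕ, wc ν n * t ^ n) :
    StrictAntiOn (fun t : ℝ => ∑' n : ℕ, wc ν n * t ^ n) (Ico 0 T) := by
  have he := wc_ent hν
  have s0 := he.shift
  have s1 := s0.mul_lin (ν + 1)
  have s2 := s1.mul_lin ((ν + 2) / 2)
  have n3 : ∀ t ∈ Ioo 0 T, ∑' n : ℕ, wc ν (n + 1) * ((n : ℝ) + 1) * ((n : ℝ) + (ν + 1))
      * ((n : ℝ) + (ν + 2) / 2) * ((n : ℝ) + (ν + 3) / 2) * t ^ n < 0 := by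
    intro t ht
    have hp := hpos t ht
    have : ∑' n : ℕ, wc ν (n + 1) * ((n : ℝ) + 1) * ((n : ℝ) + (ν + 1))
      * ((n : ℝ) + (ν + 2) / 2) * ((n : ℝ) + (ν + 3) / 2) * t ^ n
        = (-1 / 4) * ∑' n : ℕ, wc ν n * t ^ n := by
      rw [← tsum_mul_left]
      refine tsum_congr fun n => ?_
      rw [wc_succ hν n]; ring
    rw [this]; linarith
  have n2 := s2.neg_step (by linarith) n3
  have n1 := s1.neg_step (by linarith) n2
  have n0 := s0.neg_step (by linarith) n1
  refine strictAntiOn_of_deriv_neg (convex_Ico 0 T) ?_ ?_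
  · exact fun y _ => (he.hasDerivAt y).continuousAt.continuousWithinAt
  · intro y hy
    rw [interior_Ico] at hy
    rw [(he.hasDerivAt y).deriv]
    exact n0 y hy

/-- `𝒲_ν` is strictly increasing on `(-γ_{ν,1}, 0]` and strictly decreasing on `[0, γ_{ν,1})`. -/
theorem Wcal_strictMono_strictAnti (ν : ℝ) (hν : -1 < ν) (γ1 : ℝ)
    (hγ1pos : 0 < γ1) (hγ1zero : Wcal ν γ1 = 0)
    (hγ1min : ∀ x : ℝ, 0 < x → Wcal ν x = 0 → γ1 ≤ x) :
    StrictMonoOn (Wcal ν) (Set.Ioc (-γ1) 0) ∧ StrictAntiOn (Wcal ν) (Set.Ico 0 γ1) := by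
  have he := wc_ent hν
  have hcW : Continuous (Wcal ν) := by
    have hc : Continuous fun y : ℝ => ∑' n : ℕ, wc ν n * y ^ n :=
      continuous_iff_continuousAt.2 fun y => (he.hasDerivAt y).continuousAt
    have : Wcal ν = (fun y : ℝ => ∑' n : ℕ, wc ν n * y ^ n) ∘ (fun x : ℝ => (x / 2) ^ 4) :=
      funext fun x => Wcal_eq ν x
    rw [this]
    exact hc.comp (by fun_prop)
  have hW0 : Wcal ν 0 = 1 := by
    rw [Wcal_eq, tsum_eq_single 0]
    · simp [wc_zero hν]
    · intro n hn; simp [hn]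
  have hWpos : ∀ x ∈ Ioo 0 γ1, 0 < Wcal ν x := by
    intro x hx
    by_contra hc
    push Not at hc
    obtain ⟨z, hz, hz0⟩ := intermediate_value_Icc' hx.1.le hcW.continuousOn
      (show (0 : ℝ) ∈ Icc (Wcal ν x) (Wcal ν 0) from ⟨hc, by rw [hW0]; norm_num⟩)
    have hzpos : 0 < z := by
      rcases hz.1.eq_or_lt with h | h
      · rw [← h, hW0] at hz0; norm_num at hz0
      · exact h
    have := hγ1min z hzpos hz0
    linarith [hz.2, hx.2]
  have hanti : StrictAntiOn (fun t : ℝ => ∑' n : ℕ, wc ν n * t ^ n) (Ico 0 ((γ1 / 2) ^ 4)) := by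
    refine wF_anti hν ?_
    intro t ht
    set y : ℝ := t ^ ((4 : ℝ)⁻¹) with hy
    have hy0 : 0 < y := Real.rpow_pos_of_pos ht.1 _
    have hy4 : y ^ 4 = t := by
      have := Real.rpow_inv_natCast_pow ht.1.le (n := 4) (by norm_num)
      simpa [hy] using this
    have hlt : y < γ1 / 2 := by
      refine lt_of_pow_lt_pow_left₀ 4 (by positivity) ?_
      rw [hy4]; exact ht.2
    have := hWpos (2 * y) ⟨by linarith, by linarith⟩
    rw [Wcal_eq, show 2 * y / 2 = y by ring, hy4] at this
    exact this
  have hA : StrictAntiOn (Wcal ν) (Set.Ico 0 γ1) := by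
    intro a ha b hb hab
    rw [Wcal_eq ν a, Wcal_eq ν b]
    have ha0 : 0 ≤ a := ha.1
    have hb0 : 0 ≤ b := hb.1
    refine hanti ⟨by positivity, ?_⟩ ⟨by positivity, ?_⟩ ?_
    · have := ha.2
      exact pow_lt_pow_left₀ (by linarith) (by linarith) (by norm_num)
    · have := hb.2
      exact pow_lt_pow_left₀ (by linarith) (by linarith) (by norm_num)
    · exact pow_lt_pow_left₀ (by linarith) (by linarith) (by norm_num)
  refine ⟨?_, hA⟩
  have heven : ∀ x, Wcal ν (-x) = Wcal ν x := by
    intro x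
    rw [Wcal_eq, Wcal_eq]
    congr 1; funext n; congr 2; ring
  intro a ha b hb hab
  rw [← heven a, ← heven b]
  exact hA ⟨by linarith [hb.2], by linarith [hb.1]⟩ ⟨by linarith [ha.2], by linarith [ha.1]⟩
    (by linarith)
end

section
/- Let ν > -1. For every real x ≠ 0 with 𝒲_ν(x) > 0 one has (log 𝒲_ν)''(x) < 0 (so 𝒲_ν is strictly log-concave on each open interval where it is positive); moreover, for every x > 0 with 𝒲_ν(x) > 0 the derivative of the function t ↦ t·𝒲_ν'(t)/𝒲_ν(t) at x is strictly negative (strict geometric concavity). -/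
open Real Set

namespace WProof
open Polynomial

noncomputable def lp (s : Multiset ℝ) : ℝ[X] := (s.map (fun u => 1 - C u * X)).prod

lemma lp_cons (u : ℝ) (s : Multiset ℝ) : lp (u ::ₘ s) = (1 - C u * X) * lp s := by
  simp [lp]

noncomputable def th (p : ℝ[X]) : ℝ[X] := X * derivative p

lemma th_coeff (p : ℝ[X]) (k : ℕ) : (th p).coeff k = k * p.coeff k := by
  cases k with
  | zero => simp [th]
  | succ k => simp [th, coeff_X_mul, coeff_derivative]; ring

lemma th_mul (p q : ℝ[X]) : th (p * q) = th p * q + p * th q := by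
  simp [th]; ring

lemma th_lin (u : ℝ) : th (1 - C u * X) = - (C u * X) := by
  simp [th]

lemma th_lin' (u : ℝ) : th (- (C u * X)) = - (C u * X) := by
  simp [th]

lemma th_add (p q : ℝ[X]) : th (p + q) = th p + th q := by
  simp [th]; ring

lemma key1 (s : Multiset ℝ) (σ z : ℝ) (hz : 0 < z) (hs : ∀ u ∈ s, 0 < u ∧ u ≤ σ) :
    ((lp s).eval z) ^ 2 * (s.sum * z / (1 + σ * z) ^ 2) ≤
      ((th (lp s)).eval z) ^ 2 - (lp s).eval z * (th (th (lp s))).eval z := by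
  induction s using Multiset.induction_on with
  | empty => simp [lp, th]
  | cons u s ih =>
    have ih := ih (fun v hv => hs v (Multiset.mem_cons_of_mem hv))
    obtain ⟨hu, huσ⟩ := hs u (Multiset.mem_cons_self u s)
    rw [lp_cons]
    simp only [th_mul, th_add, th_lin, th_lin', eval_add, eval_mul, eval_sub, eval_neg, eval_one,
      eval_C, eval_X, Multiset.sum_cons]
    generalize eval z (lp s) = P at *
    generalize eval z (th (lp s)) = P1 at *
    generalize eval z (th (th (lp s))) = P2 at *
    have h1 : (1 - u * z) ^ 2 * (u * z / (1 + σ * z) ^ 2) ≤ u * z := by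
      have hpos : 0 < 1 + σ * z := by nlinarith
      have : (1 - u * z) ^ 2 ≤ (1 + σ * z) ^ 2 := by
        apply sq_le_sq'
        · nlinarith [mul_le_mul_of_nonneg_right huσ hz.le]
        · nlinarith [mul_pos hu hz, mul_pos (lt_of_lt_of_le hu huσ) hz]
      rw [← mul_div_assoc, div_le_iff₀ (by positivity)]
      nlinarith [mul_le_mul_of_nonneg_right this (mul_pos hu hz).le]
    have h2 := mul_le_mul_of_nonneg_left h1 (sq_nonneg P)
    have h3 := mul_le_mul_of_nonneg_left ih (sq_nonneg (1 - u * z))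
    have e : (u + s.sum) * z / (1 + σ * z) ^ 2 =
      u * z / (1 + σ * z) ^ 2 + s.sum * z / (1 + σ * z) ^ 2 := by ring
    rw [e]
    linear_combination h2 + h3

lemma key2 (s : Multiset ℝ) (z : ℝ) :
    0 ≤ ((th (lp s)).eval z) ^ 2 - (lp s).eval z * (th (th (lp s))).eval z +
      (lp s).eval z * (th (lp s)).eval z := by
  induction s using Multiset.induction_on with
  | empty => simp [lp, th]
  | cons u s ih =>
    rw [lp_cons]
    simp only [th_mul, th_add, th_lin, th_lin', eval_add, eval_mul, eval_sub, eval_neg, eval_one,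
      eval_C, eval_X]
    generalize eval z (lp s) = P at *
    generalize eval z (th (lp s)) = P1 at *
    generalize eval z (th (th (lp s))) = P2 at *
    have h3 := mul_nonneg (sq_nonneg (1 - u * z)) ih
    have h2 := mul_nonneg (sq_nonneg P) (sq_nonneg (u * z))
    linear_combination h2 + h3

lemma lp_coeff_zero (s : Multiset ℝ) : (lp s).coeff 0 = 1 := by
  induction s using Multiset.induction_on with
  | empty => simp [lp]
  | cons u s ih => rw [lp_cons]; simp [mul_coeff_zero, ih]

lemma lp_coeff_one (s : Multiset ℝ) : (lp s).coeff 1 = - s.sum := by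
  induction s using Multiset.induction_on with
  | empty => simp [lp, coeff_one]
  | cons u s ih =>
    rw [lp_cons, sub_mul, one_mul, mul_assoc, coeff_sub, coeff_C_mul, coeff_X_mul, ih,
      lp_coeff_zero]; simp; ring

/-- logarithmic derivative off the positive axis, nonreal point -/
lemma root_im (s : Multiset ℝ) (hs : ∀ u ∈ s, 0 < u) (w : ℂ) (hw : w.im ≠ 0) :
    aeval w (lp s) ≠ 0 ∧ ∃ T : ℂ, aeval w (th (lp s)) = - aeval w (lp s) * T ∧
      (0 < T.im * w.im ∨ T = 0) := by
  induction s using Multiset.induction_on with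
  | empty => exact ⟨by simp [lp], 0, by simp [lp, th], Or.inr rfl⟩
  | cons u s ih =>
    obtain ⟨h0, T, hT, hT'⟩ := ih (fun v hv => hs v (Multiset.mem_cons_of_mem hv))
    have hu := hs u (Multiset.mem_cons_self u s)
    have hne : (1 - (u : ℂ) * w) ≠ 0 := by
      intro h
      have := congrArg Complex.im h
      simp [hu.ne', hw] at this
    rw [lp_cons]
    refine ⟨by simpa using ⟨hne, h0⟩, T + u * w / (1 - u * w), ?_, Or.inl ?_⟩
    · rw [th_mul, th_lin]
      simp only [map_add, map_mul, map_neg, map_sub, map_one, aeval_C, aeval_X, hT,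
        Complex.coe_algebraMap]
      field_simp
      ring
    · have hn : 0 < Complex.normSq (1 - (u : ℂ) * w) := Complex.normSq_pos.mpr hne
      have him : ((u : ℂ) * w / (1 - u * w)).im = u * w.im / Complex.normSq (1 - (u : ℂ) * w) := by
        rw [Complex.div_im]
        simp
        field_simp
        ring
      have : 0 < ((u : ℂ) * w / (1 - u * w)).im * w.im := by
        rw [him, div_mul_eq_mul_div]
        apply div_pos _ hn
        rw [mul_assoc]
        exact mul_pos hu (mul_self_pos.mpr hw)
      rw [Complex.add_im, add_mul]
      rcases hT' with h | h
      · linarith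
      · simpa [h] using this

lemma root_neg (s : Multiset ℝ) (hs : ∀ u ∈ s, 0 < u) (w : ℝ) (hw : w ≤ 0) :
    0 < eval w (lp s) ∧ 0 ≤ eval w (th (lp s)) := by
  induction s using Multiset.induction_on with
  | empty => simp [lp, th]
  | cons u s ih =>
    obtain ⟨h0, h1⟩ := ih (fun v hv => hs v (Multiset.mem_cons_of_mem hv))
    have hu := hs u (Multiset.mem_cons_self u s)
    have : 0 ≤ -(u * w) := by nlinarith
    rw [lp_cons, th_mul, th_lin]
    simp only [eval_add, eval_mul, eval_sub, eval_neg, eval_one, eval_C, eval_X]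
    have h2 : 0 < 1 - u * w := by linarith
    exact ⟨by positivity, by positivity⟩

lemma step (s : Multiset ℝ) (hs : ∀ u ∈ s, 0 < u) (β : ℝ) (hβ : 0 < β) :
    ∃ s' : Multiset ℝ, (∀ u ∈ s', 0 < u) ∧ lp s' = lp s + C β * th (lp s) := by
  set q := lp s + C β * th (lp s) with hq
  have hq0 : q.coeff 0 = 1 := by simp [hq, th_coeff, lp_coeff_zero]
  have hqne : q ≠ 0 := by intro h; simp [h] at hq0
  have hroot : ∀ w : ℂ, aeval w q = 0 → w.im = 0 := by
    intro w h
    by_contra hw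
    obtain ⟨h0, T, hT, hT'⟩ := root_im s hs w hw
    rw [hq, map_add, map_mul, aeval_C, hT, Complex.coe_algebraMap] at h
    have h2 : aeval w (lp s) * (1 - β * T) = 0 := by linear_combination h
    have h3 := (mul_eq_zero.mp h2).resolve_left h0
    rcases hT' with h4 | h4
    · have := congrArg Complex.im h3
      simp [hβ.ne'] at this
      simp [this] at h4
    · simp [h4] at h3
  have hsplit : q.Splits := by
    apply Splits.of_splits_map (algebraMap ℝ ℂ) (IsAlgClosed.splits _)
    intro w hw
    have hw' : aeval w q = 0 := by
      have := (mem_roots'.mp hw).2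
      rwa [IsRoot, eval_map_algebraMap] at this
    exact ⟨w.re, by apply Complex.ext <;> simp [hroot w hw']⟩
  have hpos : ∀ r ∈ q.roots, 0 < r := by
    intro r hr
    by_contra hneg
    obtain ⟨h0, h1⟩ := root_neg s hs r (not_lt.mp hneg)
    have := (mem_roots'.mp hr).2
    rw [IsRoot, hq] at this
    simp only [eval_add, eval_mul, eval_C] at this
    nlinarith [mul_nonneg hβ.le h1]
  have hfac : ∀ t : Multiset ℝ, (∀ r ∈ t, 0 < r) →
      ∃ c : ℝ, (t.map (fun r => X - C r)).prod = C c * lp (t.map (fun r => r⁻¹)) := by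
    intro t
    induction t using Multiset.induction_on with
    | empty => intro _; exact ⟨1, by simp [lp]⟩
    | cons r t ih =>
      intro ht
      obtain ⟨c, hc⟩ := ih (fun v hv => ht v (Multiset.mem_cons_of_mem hv))
      have hr := ht r (Multiset.mem_cons_self r t)
      refine ⟨-r * c, ?_⟩
      rw [Multiset.map_cons, Multiset.prod_cons, hc, Multiset.map_cons, lp_cons]
      have : (X - C r : ℝ[X]) = C (-r) * (1 - C r⁻¹ * X) := by
        have h : (C r * C r⁻¹ : ℝ[X]) = 1 := by rw [← C_mul, mul_inv_cancel₀ hr.ne', C_1]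
        rw [C_neg]
        linear_combination (-X) * h
      rw [this, C_mul]; ring
  obtain ⟨c, hc⟩ := hfac q.roots hpos
  refine ⟨q.roots.map (fun r => r⁻¹), ?_, ?_⟩
  · intro u hu
    obtain ⟨r, hr, rfl⟩ := Multiset.mem_map.mp hu
    exact inv_pos.mpr (hpos r hr)
  · have h1 := hsplit.eq_prod_roots
    rw [hc, ← mul_assoc, ← C_mul] at h1
    have h2 : q.leadingCoeff * c = 1 := by
      have := congrArg (fun p => coeff p 0) h1
      simp only [coeff_C_mul, lp_coeff_zero, hq0] at this
      linarith
    rw [h2, C_1, one_mul] at h1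
    exact h1.symm

lemma step_coeff (p : ℝ[X]) (β : ℝ) (k : ℕ) :
    (p + C β * th p).coeff k = (1 + β * k) * p.coeff k := by
  rw [coeff_add, coeff_C_mul, th_coeff]; ring

lemma steps (s : Multiset ℝ) (hs : ∀ u ∈ s, 0 < u) (β : ℕ → ℝ) (hβ : ∀ j, 0 < β j) (N : ℕ) :
    ∃ s' : Multiset ℝ, (∀ u ∈ s', 0 < u) ∧
      ∀ k, (lp s').coeff k = (∏ j ∈ Finset.range N, (1 + β j * k)) * (lp s).coeff k := by
  induction N with
  | zero => exact ⟨s, hs, by simp⟩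
  | succ N ih =>
    obtain ⟨s1, h1, h2⟩ := ih
    obtain ⟨s2, h3, h4⟩ := step s1 h1 (β N) (hβ N)
    refine ⟨s2, h3, fun k => ?_⟩
    rw [h4, step_coeff, h2, Finset.prod_range_succ]; ring

/-- Coefficients of approximants. -/
noncomputable def A (a : ℝ) (N k : ℕ) : ℝ :=
  (N.choose k / (N : ℝ) ^ k) *
    ((∏ j ∈ Finset.range N, (1 + 1 / (a + j) * ((k : ℕ) : ℝ))) / (N : ℝ) ^ k) *
    ((∏ j ∈ Finset.range N, (1 + 1 / (a + 1 + j) * ((2 * k : ℕ) : ℝ))) / (N : ℝ) ^ (2 * k))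

lemma exists_approx (a : ℝ) (ha : 0 < a) (N : ℕ) (hN : 0 < N) :
    ∃ s : Multiset ℝ, (∀ u ∈ s, 0 < u) ∧ ∀ k, (lp s).coeff k = (-1) ^ k * A a N k := by
  have hN' : (0 : ℝ) < N := by exact_mod_cast hN
  set t : ℝ := 1 / (N : ℝ) ^ 4 with ht
  have htp : 0 < t := by positivity
  have hbase : ∀ k, (lp (Multiset.replicate N t)).coeff k = (-t) ^ k * N.choose k := by
    intro k
    have : lp (Multiset.replicate N t) = ((1 + X) ^ N).comp (C (-t) * X) := by
      simp [lp, sub_eq_add_neg]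
    rw [this, comp_C_mul_X_coeff, coeff_one_add_X_pow]
    ring
  obtain ⟨s1, h1, h2⟩ := steps (Multiset.replicate N t)
    (fun u hu => by rw [Multiset.eq_of_mem_replicate hu]; exact htp)
    (fun j => 1 / (a + j)) (fun j => by positivity) N
  obtain ⟨s2, h3, h4⟩ := steps s1 h1 (fun j => 2 / (a + 1 + j)) (fun j => by positivity) N
  refine ⟨s2, h3, fun k => ?_⟩
  rw [h4, h2, hbase, A]
  have e : ∀ j : ℕ, (1 + 2 / (a + 1 + j) * (k : ℝ)) = 1 + 1 / (a + 1 + j) * ((2 * k : ℕ) : ℝ) := by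
    intro j; push_cast; ring
  simp only [e]
  rw [neg_pow, ht, one_div_pow, ← pow_mul, show 4 * k = k + k + 2 * k by ring, pow_add, pow_add]
  field_simp

open Filter Topology

/-- rising factorial -/
noncomputable def R (b : ℝ) (m : ℕ) : ℝ := ∏ j ∈ Finset.range m, (b + j)

lemma R_pos (b : ℝ) (hb : 0 < b) (m : ℕ) : 0 < R b m :=
  Finset.prod_pos (fun j _ => by positivity)

lemma R_add (b : ℝ) (m n : ℕ) : R b (m + n) = R b m * R (b + m) n := by
  simp only [R, Finset.prod_range_add]
  congr 1
  apply Finset.prod_congr rfl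
  intro j _
  push_cast; ring

lemma Gamma_R (b : ℝ) (hb : 0 < b) (m : ℕ) : Real.Gamma (b + m) = R b m * Real.Gamma b := by
  induction m with
  | zero => simp [R]
  | succ m ih =>
    have : b + ((m + 1 : ℕ) : ℝ) = (b + m) + 1 := by push_cast; ring
    rw [this, Real.Gamma_add_one (by positivity), ih, R, R, Finset.prod_range_succ]; ring

lemma Q_eq (b : ℝ) (hb : 0 < b) (N m : ℕ) :
    (∏ j ∈ Finset.range N, (1 + 1 / (b + j) * (m : ℝ))) = R (b + N) m / R b m := by
  have h1 : (∏ j ∈ Finset.range N, (1 + 1 / (b + j) * (m : ℝ))) = R (b + m) N / R b N := by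
    rw [R, R, ← Finset.prod_div_distrib]
    apply Finset.prod_congr rfl
    intro j _
    have : b + (j : ℝ) ≠ 0 := by positivity
    field_simp
    ring
  rw [h1, div_eq_div_iff (R_pos b hb N).ne' (R_pos b hb m).ne', mul_comm, ← R_add, add_comm m N,
    R_add, mul_comm]

lemma Q_eq2 (b : ℝ) (N m : ℕ) :
    R (b + N) m / (N : ℝ) ^ m = ∏ j ∈ Finset.range m, ((b + N + j) / N) := by
  rw [R, Finset.prod_div_distrib]; simp

lemma Q_bound (b : ℝ) (hb : 0 < b) (N m : ℕ) (hN : 0 < N) (hm : m ≤ 2 * N) :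
    (∏ j ∈ Finset.range N, (1 + 1 / (b + j) * (m : ℝ))) / (N : ℝ) ^ m ≤ ((b + 3) / b) ^ m := by
  have hN1 : (1 : ℝ) ≤ N := by exact_mod_cast hN
  have hN' : (0 : ℝ) < N := by linarith
  rw [Q_eq b hb, div_right_comm, Q_eq2, div_pow]
  have h1 : ∏ j ∈ Finset.range m, ((b + N + j) / N) ≤ (b + 3) ^ m := by
    have hc : (b + 3) ^ m = ∏ _j ∈ Finset.range m, (b + 3) := by simp
    rw [hc]
    apply Finset.prod_le_prod
    · intro j _; positivity
    · intro j hj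
      have : (j : ℝ) ≤ 2 * N := by
        have := Finset.mem_range.mp hj
        have : j ≤ 2 * N := by omega
        exact_mod_cast this
      rw [div_le_iff₀ hN']
      nlinarith
  have h2 : b ^ m ≤ R b m := by
    rw [R]
    calc b ^ m = ∏ j ∈ Finset.range m, b := by simp
      _ ≤ _ := Finset.prod_le_prod (fun _ _ => hb.le) (fun j _ => by simp)
  gcongr

lemma Q_lim (b : ℝ) (hb : 0 < b) (m : ℕ) :
    Tendsto (fun N : ℕ => (∏ j ∈ Finset.range N, (1 + 1 / (b + j) * (m : ℝ))) / (N : ℝ) ^ m)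
      atTop (𝓝 (1 / R b m)) := by
  have : ∀ N : ℕ, (∏ j ∈ Finset.range N, (1 + 1 / (b + j) * (m : ℝ))) / (N : ℝ) ^ m =
      (∏ j ∈ Finset.range m, ((b + N + j) / N)) / R b m := by
    intro N; rw [Q_eq b hb, div_right_comm, Q_eq2]
  simp only [this]
  apply Tendsto.div_const
  have h : Tendsto (fun N : ℕ => ∏ j ∈ Finset.range m, ((b + N + j) / N)) atTop
      (𝓝 (∏ j ∈ Finset.range m, (1 : ℝ))) := by
    apply tendsto_finsetProd
    intro j _
    have h1 : Tendsto (fun N : ℕ => (b + j) * (1 / (N : ℝ)) + 1) atTop (𝓝 ((b + j) * 0 + 1)) :=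
      (tendsto_one_div_atTop_nhds_zero_nat.const_mul _).add_const _
    rw [mul_zero, zero_add] at h1
    refine h1.congr' ?_
    filter_upwards [eventually_gt_atTop 0] with N hN
    have : (N : ℝ) ≠ 0 := by positivity
    field_simp
    ring
  simpa using h

/-- limit coefficients -/
noncomputable def cf (a : ℝ) (k : ℕ) : ℝ :=
  (1 / (k.factorial : ℝ)) * (1 / R a k) * (1 / R (a + 1) (2 * k))

noncomputable def KK (a : ℝ) : ℝ := ((a + 3) / a) * ((a + 1 + 3) / (a + 1)) ^ 2

lemma KK_pos (a : ℝ) (ha : 0 < a) : 0 < KK a := by unfold KK; positivity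

lemma cf_pos (a : ℝ) (ha : 0 < a) (k : ℕ) : 0 < cf a k := by
  have := R_pos a ha k
  have := R_pos (a + 1) (by linarith) (2 * k)
  unfold cf; positivity

lemma A_lim (a : ℝ) (ha : 0 < a) (k : ℕ) :
    Tendsto (fun N => A a N k) atTop (𝓝 (cf a k)) := by
  unfold A cf
  refine Tendsto.mul (Tendsto.mul ?_ (Q_lim a ha k)) (Q_lim (a + 1) (by linarith) (2 * k))
  have h := ProbabilityTheory.tendsto_choose_mul_pow_atTop (p := fun n => 1 / (n : ℝ)) (r := 1) k ?_
  · simpa [div_eq_mul_inv] using h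
  · apply tendsto_const_nhds.congr'
    filter_upwards [eventually_gt_atTop 0] with N hN
    have : (N : ℝ) ≠ 0 := by positivity
    field_simp

lemma A_nonneg (a : ℝ) (ha : 0 < a) (N k : ℕ) : 0 ≤ A a N k := by
  unfold A
  have h1 : 0 ≤ (∏ j ∈ Finset.range N, (1 + 1 / (a + j) * ((k : ℕ) : ℝ))) :=
    Finset.prod_nonneg (fun j _ => by positivity)
  have h2 : 0 ≤ (∏ j ∈ Finset.range N, (1 + 1 / (a + 1 + j) * ((2 * k : ℕ) : ℝ))) :=
    Finset.prod_nonneg (fun j _ => by positivity)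
  positivity

lemma A_bound (a : ℝ) (ha : 0 < a) (N k : ℕ) (hN : 0 < N) :
    A a N k ≤ KK a ^ k / k.factorial := by
  have hN' : (0 : ℝ) < N := by exact_mod_cast hN
  have hK := KK_pos a ha
  by_cases hk : k ≤ N
  · have h1 := Q_bound a ha N k hN (by omega)
    have h2 := Q_bound (a + 1) (by linarith) N (2 * k) hN (by omega)
    have h3 : (N.choose k : ℝ) / (N : ℝ) ^ k ≤ 1 / k.factorial := by
      rw [div_le_iff₀ (by positivity)]
      calc (N.choose k : ℝ) ≤ (N : ℝ) ^ k / k.factorial := Nat.choose_le_pow_div k N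
        _ = _ := by ring
    have h1' : 0 ≤ (∏ j ∈ Finset.range N, (1 + 1 / (a + j) * ((k : ℕ) : ℝ))) / (N : ℝ) ^ k :=
      div_nonneg (Finset.prod_nonneg (fun j _ => by positivity)) (by positivity)
    have h2' : 0 ≤ (∏ j ∈ Finset.range N, (1 + 1 / (a + 1 + j) * ((2 * k : ℕ) : ℝ))) /
        (N : ℝ) ^ (2 * k) :=
      div_nonneg (Finset.prod_nonneg (fun j _ => by positivity)) (by positivity)
    calc A a N k ≤ 1 / k.factorial * ((a + 3) / a) ^ k * ((a + 1 + 3) / (a + 1)) ^ (2 * k) := by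
          unfold A
          exact mul_le_mul (mul_le_mul h3 h1 h1' (by positivity)) h2 h2' (by positivity)
      _ = _ := by unfold KK; rw [mul_pow, ← pow_mul]; ring
  · have : A a N k = 0 := by
      unfold A; rw [Nat.choose_eq_zero_of_lt (by omega)]; simp
    rw [this]; positivity

lemma cf_bound (a : ℝ) (ha : 0 < a) (k : ℕ) : cf a k ≤ KK a ^ k / k.factorial := by
  apply le_of_tendsto (A_lim a ha k)
  filter_upwards [eventually_gt_atTop 0] with N hN using A_bound a ha N k hN

lemma term_bound (a : ℝ) (m k : ℕ) (c z r : ℝ) (hc : 0 ≤ c)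
    (hb : c ≤ KK a ^ k / k.factorial) (hz : |z| ≤ r) :
    ‖(k : ℝ) ^ m * ((-1) ^ k * c * z ^ k)‖ ≤ (2 ^ m * KK a * r) ^ k / k.factorial := by
  have hk : (k : ℝ) ^ m ≤ (2 ^ m) ^ k := by
    rw [← pow_mul, mul_comm m k, pow_mul]
    have : (k : ℝ) ≤ 2 ^ k := by exact_mod_cast Nat.lt_two_pow_self.le
    gcongr
  simp only [norm_mul, norm_pow, norm_neg, norm_one, one_pow, one_mul, Real.norm_eq_abs,
    abs_of_nonneg hc, Nat.abs_cast]
  calc (k : ℝ) ^ m * (c * |z| ^ k) ≤ (2 ^ m) ^ k * ((KK a ^ k / k.factorial) * r ^ k) := by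
        have := hc.trans hb
        gcongr
    _ = _ := by rw [mul_pow, mul_pow]; ring

noncomputable def G (a : ℝ) (m : ℕ) (z : ℝ) : ℝ := ∑' k : ℕ, (k : ℝ) ^ m * ((-1) ^ k * cf a k * z ^ k)

lemma G_lim (a : ℝ) (ha : 0 < a) (m : ℕ) (z : ℝ) :
    Tendsto (fun N => ∑' k : ℕ, (k : ℝ) ^ m * ((-1) ^ k * A a N k * z ^ k)) atTop (𝓝 (G a m z)) := by
  apply tendsto_tsum_of_dominated_convergence
    (Real.summable_pow_div_factorial (2 ^ m * KK a * |z|))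
  · intro k
    exact (((A_lim a ha k).const_mul _).mul_const _).const_mul _
  · filter_upwards [eventually_gt_atTop 0] with N hN k
    exact term_bound a m k _ z _ (A_nonneg a ha N k) (A_bound a ha N k hN) le_rfl

lemma eval_tsum (p : ℝ[X]) (z : ℝ) : p.eval z = ∑' k : ℕ, p.coeff k * z ^ k := by
  rw [eval_eq_sum_range, tsum_eq_sum]
  intro k hk
  rw [coeff_eq_zero_of_natDegree_lt (by simpa using hk), zero_mul]

lemma main_ineq (a : ℝ) (ha : 0 < a) (z : ℝ) (hz : 0 < z) :
    (G a 0 z) ^ 2 * (cf a 1 * z / (1 + cf a 1 * z) ^ 2) ≤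
      (G a 1 z) ^ 2 - G a 0 z * G a 2 z ∧
    0 ≤ (G a 1 z) ^ 2 - G a 0 z * G a 2 z + G a 0 z * G a 1 z := by
  have key : ∀ N : ℕ, 0 < N → ∃ s : Multiset ℝ, (∀ u ∈ s, 0 < u) ∧ s.sum = A a N 1 ∧
      (lp s).eval z = ∑' k : ℕ, (k : ℝ) ^ 0 * ((-1) ^ k * A a N k * z ^ k) ∧
      (th (lp s)).eval z = ∑' k : ℕ, (k : ℝ) ^ 1 * ((-1) ^ k * A a N k * z ^ k) ∧
      (th (th (lp s))).eval z = ∑' k : ℕ, (k : ℝ) ^ 2 * ((-1) ^ k * A a N k * z ^ k) := by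
    intro N hN
    obtain ⟨s, hs, hc⟩ := exists_approx a ha N hN
    refine ⟨s, hs, ?_, ?_, ?_, ?_⟩
    · have := hc 1
      rw [lp_coeff_one] at this
      linarith
    · rw [eval_tsum]; congr 1; ext k; rw [hc]; ring
    · rw [eval_tsum]; congr 1; ext k; rw [th_coeff, hc]; ring
    · rw [eval_tsum]; congr 1; ext k; rw [th_coeff, th_coeff, hc]; ring
  have l0 := G_lim a ha 0 z
  have l1 := G_lim a ha 1 z
  have l2 := G_lim a ha 2 z
  have la := A_lim a ha 1
  have hc := cf_pos a ha 1
  have lD := (l1.pow 2).sub (l0.mul l2)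
  constructor
  · refine le_of_tendsto_of_tendsto ((l0.pow 2).mul ((la.mul_const z).div
      (((la.mul_const z).const_add 1).pow 2) (by positivity))) lD ?_
    filter_upwards [eventually_gt_atTop 0] with N hN
    obtain ⟨s, hs, h1, e0, e1, e2⟩ := key N hN
    have := key1 s s.sum z hz (fun u hu => ⟨hs u hu,
      Multiset.single_le_sum (fun v hv => (hs v hv).le) u hu⟩)
    rw [e0, e1, e2, h1] at this
    exact this
  · refine ge_of_tendsto (lD.add (l0.mul l1)) ?_
    filter_upwards [eventually_gt_atTop 0] with N hN
    obtain ⟨s, hs, h1, e0, e1, e2⟩ := key N hN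
    have := key2 s z
    rw [e0, e1, e2] at this
    exact this

lemma G_deriv (a : ℝ) (ha : 0 < a) (m : ℕ) (z : ℝ) (hz : z ≠ 0) :
    HasDerivAt (G a m) (G a (m + 1) z / z) z := by
  set r : ℝ := |z| + 1 with hr
  have hr1 : 1 ≤ r := by have := abs_nonneg z; linarith
  have hd : HasDerivAt (G a m)
      (∑' k : ℕ, (k : ℝ) ^ m * ((-1) ^ k * cf a k * (k * z ^ (k - 1)))) z := by
    refine hasDerivAt_tsum_of_isPreconnected (t := Metric.ball 0 r)
      (g := fun (k : ℕ) (z : ℝ) => (k : ℝ) ^ m * ((-1) ^ k * cf a k * z ^ k))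
      (g' := fun (k : ℕ) (z : ℝ) => (k : ℝ) ^ m * ((-1) ^ k * cf a k * (k * z ^ (k - 1))))
      (y₀ := z)
      (Real.summable_pow_div_factorial (2 ^ (m + 1) * KK a * r)) Metric.isOpen_ball
      (convex_ball 0 r).isPreconnected ?_ ?_ ?_ ?_ ?_
    · intro k y _
      exact ((hasDerivAt_pow k y).const_mul _).const_mul _
    · intro k y hy
      have hy' : |y| ≤ r := by simpa using (Metric.mem_ball.mp hy).le
      refine le_trans ?_ (term_bound a (m + 1) k (cf a k) r r (cf_pos a ha k).le (cf_bound a ha k)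
        (abs_of_nonneg (by linarith)).le)
      have h1 : |y| ^ (k - 1) ≤ r ^ k :=
        (pow_le_pow_left₀ (abs_nonneg _) hy' _).trans (pow_le_pow_right₀ hr1 (by omega))
      simp only [norm_mul, norm_pow, norm_neg, norm_one, one_pow, one_mul, Real.norm_eq_abs,
        Nat.abs_cast, abs_of_nonneg (zero_le_one.trans hr1), abs_of_pos (cf_pos a ha k)]
      have := (cf_pos a ha k).le
      calc (k : ℝ) ^ m * (cf a k * (k * |y| ^ (k - 1))) =
          (k : ℝ) ^ (m + 1) * (cf a k * |y| ^ (k - 1)) := by ring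
        _ ≤ _ := by gcongr
    · simp [hr]
    · exact Summable.of_norm_bounded (Real.summable_pow_div_factorial (2 ^ m * KK a * |z|))
        (fun k => term_bound a m k _ z _ (cf_pos a ha k).le (cf_bound a ha k) le_rfl)
    · simp [hr]
  convert hd using 1
  rw [G, ← tsum_div_const]
  congr 1; ext k
  cases k with
  | zero => simp
  | succ k => rw [Nat.add_sub_cancel]; field_simp; ring

lemma Wcal_eq (ν : ℝ) (hν : -1 < ν) (x : ℝ) : Wcal ν x = G (ν + 1) 0 (x ^ 4 / 16) := by
  rw [Wcal, G]
  congr 1; ext k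
  have h1 := Gamma_R (ν + 1) (by linarith) k
  have h2 := Gamma_R (ν + 1 + 1) (by linarith) (2 * k)
  have p1 := R_pos (ν + 1) (by linarith) k
  have p2 := R_pos (ν + 1 + 1) (by linarith) (2 * k)
  have g1 := Real.Gamma_pos_of_pos (show 0 < ν + 1 by linarith)
  have g2 := Real.Gamma_pos_of_pos (show 0 < ν + 1 + 1 by linarith)
  rw [show ν + (k : ℝ) + 1 = ν + 1 + k by ring, h1,
    show ν + 2 * (k : ℝ) + 2 = ν + 1 + 1 + ((2 * k : ℕ) : ℝ) by push_cast; ring, h2,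
    show ν + 2 = ν + 1 + 1 by ring, cf, div_pow, pow_mul, pow_mul]
  norm_num
  field_simp

end WProof

open WProof Filter Topology in
/-- Strict log-concavity and strict geometric concavity of `𝒲_ν` where it is positive. -/
theorem Wcal_strict_logConcave_geomConcave (ν : ℝ) (hν : -1 < ν) :
    (∀ x : ℝ, x ≠ 0 → 0 < Wcal ν x →
      deriv (deriv (fun t : ℝ => Real.log (Wcal ν t))) x < 0) ∧
    (∀ x : ℝ, 0 < x → 0 < Wcal ν x →
      deriv (fun t : ℝ => t * deriv (Wcal ν) t / Wcal ν t) x < 0) := by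
  set a := ν + 1 with ha'
  have ha : 0 < a := by linarith
  let E : ℕ → ℝ → ℝ := fun m x => G a m (x ^ 4 / 16)
  have hW : Wcal ν = E 0 := funext (Wcal_eq ν hν)
  have hE : ∀ m x, x ≠ 0 → HasDerivAt (E m) (4 * E (m + 1) x / x) x := by
    intro m x hx
    have h1 := G_deriv a ha m (x ^ 4 / 16) (by positivity)
    have h2 : HasDerivAt (fun x : ℝ => x ^ 4 / 16) (4 * x ^ 3 / 16) x := by
      simpa using (hasDerivAt_pow 4 x).div_const 16
    have h3 := HasDerivAt.comp x h1 h2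
    refine h3.congr_deriv ?_
    simp only [E]
    field_simp
  have hineq : ∀ x, x ≠ 0 → 0 < E 0 x → 0 < E 1 x ^ 2 - E 0 x * E 2 x ∧
      0 ≤ E 1 x ^ 2 - E 0 x * E 2 x + E 0 x * E 1 x := by
    intro x hx h0
    have hz : 0 < x ^ 4 / 16 := by positivity
    obtain ⟨h1, h2⟩ := main_ineq a ha _ hz
    refine ⟨lt_of_lt_of_le ?_ h1, h2⟩
    have := cf_pos a ha 1
    have h0' : 0 < G a 0 (x ^ 4 / 16) := h0
    positivity
  have hnear : ∀ x, x ≠ 0 → 0 < E 0 x → ∀ᶠ t in 𝓝 x, t ≠ 0 ∧ 0 < E 0 t := by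
    intro x hx h0
    exact (isOpen_ne.eventually_mem hx).and
      ((hE 0 x hx).continuousAt.eventually (lt_mem_nhds h0))
  rw [hW]
  constructor
  · intro x hx h0
    obtain ⟨i1, i2⟩ := hineq x hx h0
    have e : deriv (fun t : ℝ => Real.log (E 0 t)) =ᶠ[𝓝 x] fun t => 4 * E 1 t / t / E 0 t := by
      filter_upwards [hnear x hx h0] with t ht
      exact ((hE 0 t ht.1).log ht.2.ne').deriv
    have hd := ((((hE 1 x hx).const_mul 4).div (hasDerivAt_id x) hx).div (hE 0 x hx) h0.ne')
    rw [e.deriv_eq]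
    have hd' := hd.deriv
    refine lt_of_eq_of_lt (hd'.trans ?_) (show -(12 * (E 1 x ^ 2 - E 0 x * E 2 x) +
      4 * (E 1 x ^ 2 - E 0 x * E 2 x + E 0 x * E 1 x)) / (x ^ 2 * E 0 x ^ 2) < 0 from ?_)
    · have := h0.ne'
      simp
      field_simp
      ring
    · apply div_neg_of_neg_of_pos
      · linarith
      · positivity
  · intro x hx h0
    obtain ⟨i1, i2⟩ := hineq x hx.ne' h0
    have e : (fun t : ℝ => t * deriv (E 0) t / E 0 t) =ᶠ[𝓝 x] fun t => 4 * E 1 t / E 0 t := by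
      filter_upwards [hnear x hx.ne' h0] with t ht
      rw [(hE 0 t ht.1).deriv]
      have := ht.1
      field_simp
    have hd := (((hE 1 x hx.ne').const_mul 4).div (hE 0 x hx.ne') h0.ne').deriv
    rw [e.deriv_eq]
    refine lt_of_eq_of_lt (hd.trans ?_) (show -(16 * (E 1 x ^ 2 - E 0 x * E 2 x)) /
      (x * E 0 x ^ 2) < 0 from ?_)
    · have := h0.ne'
      simp
      field_simp
      ring
    · apply div_neg_of_neg_of_pos
      · linarith
      · positivity
end

section
/- Let ν ≥ -1/2. For every x > 0 with 𝒲_ν(x) > 0, the cross-product W_ν(x) = J_{ν+1}(x)I_ν(x) + J_ν(x)I_{ν+1}(x) satisfies (log W_ν)''(x) < 0; that is, W_ν is strictly log-concave on the set of positive x where 𝒲_ν is positive. -/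
open Real Set

/-- Auxiliary entire function `∑ s^n y^n / (n! Γ(β+n+1))`. -/
noncomputable def bF (s β y : ℝ) : ℝ :=
  ∑' n : ℕ, s ^ n / ((n.factorial : ℝ) * Real.Gamma (β + n + 1)) * y ^ n

lemma gam_pos {β : ℝ} (hβ : -1/2 ≤ β) (n : ℕ) : 0 < Real.Gamma (β + n + 1) := by
  apply Real.Gamma_pos_of_pos
  have : (0:ℝ) ≤ n := n.cast_nonneg
  linarith

lemma gam_inv_le {β : ℝ} (hβ : -1/2 ≤ β) (n : ℕ) :
    (Real.Gamma (β + n + 1))⁻¹ ≤ (Real.Gamma (β + 1))⁻¹ * 2 ^ n := by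
  induction n with
  | zero => simp
  | succ n ih =>
    have hn : (0:ℝ) ≤ n := n.cast_nonneg
    have h1 : Real.Gamma (β + (n+1 : ℕ) + 1) = (β + n + 1) * Real.Gamma (β + n + 1) := by
      rw [← Real.Gamma_add_one (by linarith)]
      congr 1
      push_cast
      ring
    rw [h1, mul_inv]
    have h2 : (β + n + 1)⁻¹ ≤ 2 := by
      rw [inv_le_comm₀ (by linarith) (by norm_num)]
      linarith
    have h3 : 0 < (Real.Gamma (β + n + 1))⁻¹ := inv_pos.mpr (gam_pos hβ n)
    calc _ ≤ 2 * (Real.Gamma (β + n + 1))⁻¹ := by gcongr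
      _ ≤ 2 * ((Real.Gamma (β + 1))⁻¹ * 2 ^ n) := by gcongr
      _ = _ := by ring

lemma coef_bound {s β : ℝ} (hs : |s| = 1) (hβ : -1/2 ≤ β) (n : ℕ) :
    |s ^ n / ((n.factorial : ℝ) * Real.Gamma (β + n + 1))| ≤
      (Real.Gamma (β + 1))⁻¹ * (2 ^ n / (n.factorial : ℝ)) := by
  have h := gam_pos hβ n
  have hf : (0:ℝ) < n.factorial := by exact_mod_cast n.factorial_pos
  rw [abs_div, abs_pow, hs, one_pow, abs_of_pos (by positivity), one_div, mul_inv]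
  have := gam_inv_le hβ n
  calc _ ≤ (n.factorial : ℝ)⁻¹ * ((Real.Gamma (β + 1))⁻¹ * 2 ^ n) := by gcongr
    _ = _ := by ring

lemma bF_summable {s β : ℝ} (hs : |s| = 1) (hβ : -1/2 ≤ β) (y : ℝ) :
    Summable fun n : ℕ => ‖s ^ n / ((n.factorial : ℝ) * Real.Gamma (β + n + 1)) * y ^ n‖ := by
  refine Summable.of_nonneg_of_le (fun _ => norm_nonneg _) (fun n => ?_)
    ((Real.summable_pow_div_factorial (2 * |y|)).mul_left (Real.Gamma (β + 1))⁻¹)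
  rw [norm_mul, norm_pow, Real.norm_eq_abs, Real.norm_eq_abs]
  calc _ ≤ (Real.Gamma (β + 1))⁻¹ * (2 ^ n / (n.factorial : ℝ)) * |y| ^ n := by
        gcongr
        exact coef_bound hs hβ n
    _ = _ := by rw [mul_pow]; ring

lemma bF_hasDerivAt {s β : ℝ} (hs : |s| = 1) (hβ : -1/2 ≤ β) (y : ℝ) :
    HasDerivAt (bF s β) (s * bF s (β + 1) y) y := by
  set R := |y| + 1 with hR
  set c : ℕ → ℝ := fun n => s ^ n / ((n.factorial : ℝ) * Real.Gamma (β + n + 1)) with hc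
  set u : ℕ → ℝ := fun n => (Real.Gamma (β + 1))⁻¹ * (2 ^ n / (n.factorial : ℝ)) *
    (n * R ^ (n - 1)) with hu
  have hRpos : 0 < R := by positivity
  have hus : Summable u := by
    rw [← summable_nat_add_iff 1]
    refine ((Real.summable_pow_div_factorial (2 * R)).mul_left
      (2 * (Real.Gamma (β + 1))⁻¹)).congr fun n => ?_
    simp only [hu, Nat.factorial_succ, Nat.add_sub_cancel]
    push_cast
    have hf : (0:ℝ) < n.factorial := by exact_mod_cast n.factorial_pos
    have hn : (0:ℝ) < n + 1 := by positivity
    rw [mul_pow, pow_succ 2 n]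
    field_simp
  have key := hasDerivAt_tsum_of_isPreconnected (g := fun n z => c n * z ^ n)
    (g' := fun n z => c n * (n * z ^ (n - 1))) (t := Metric.ball 0 R) (y₀ := 0) (y := y) hus
    Metric.isOpen_ball (convex_ball _ _).isPreconnected
    (fun n z _ => (hasDerivAt_pow n z).const_mul _)
    (fun n z hz => by
      have hz' : |z| ≤ R := by simpa using (mem_ball_zero_iff.mp hz).le
      simp only [hu, norm_mul, norm_pow, Real.norm_eq_abs, Nat.abs_cast]
      refine mul_le_mul (coef_bound hs hβ n) (by gcongr) (by positivity) ?_
      exact (abs_nonneg _).trans (coef_bound hs hβ n))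
    (by simpa using hRpos)
    (bF_summable hs hβ 0).of_norm
    (by simp [hR])
  have e : ∑' n : ℕ, c n * (n * y ^ (n - 1)) = s * bF s (β + 1) y := by
    have hsum : Summable fun n : ℕ => c n * (n * y ^ (n - 1)) := by
      refine Summable.of_norm_bounded hus fun n => ?_
      simp only [hu, norm_mul, norm_pow, Real.norm_eq_abs, Nat.abs_cast]
      have hz' : |y| ≤ R := by linarith
      refine mul_le_mul (coef_bound hs hβ n) (by gcongr) (by positivity) ?_
      exact (abs_nonneg _).trans (coef_bound hs hβ n)
    rw [hsum.tsum_eq_zero_add, bF, ← tsum_mul_left]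
    simp only [Nat.cast_zero, zero_mul, mul_zero, zero_add, hc]
    congr 1
    ext n
    have hf : (0:ℝ) < n.factorial := by exact_mod_cast n.factorial_pos
    have hg : β + 1 + (n:ℝ) + 1 = β + (n + 1 : ℕ) + 1 := by push_cast; ring
    rw [hg]
    have hG := gam_pos hβ (n+1)
    simp only [Nat.factorial_succ, Nat.add_sub_cancel]
    push_cast at hG ⊢
    have hn : (0:ℝ) < n + 1 := by positivity
    rw [pow_succ]
    field_simp
  rw [e] at key
  exact key

/-- The formal power series of `bF`. -/
noncomputable def bS (s β : ℝ) : PowerSeries ℝ :=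
  PowerSeries.mk fun n : ℕ => s ^ n / ((n.factorial : ℝ) * Real.Gamma (β + n + 1))

lemma bS_deriv (s : ℝ) (β : ℝ) :
    PowerSeries.derivative ℝ (bS s β) = PowerSeries.C s * bS s (β + 1) := by
  ext n
  rw [PowerSeries.coeff_derivative, PowerSeries.coeff_C_mul, bS, bS, PowerSeries.coeff_mk,
    PowerSeries.coeff_mk]
  have hg : β + 1 + (n:ℝ) + 1 = β + (n + 1 : ℕ) + 1 := by push_cast; ring
  rw [hg, Nat.factorial_succ]
  push_cast
  have hn : (n:ℝ) + 1 ≠ 0 := by positivity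
  have hf : (n.factorial:ℝ) ≠ 0 := by positivity
  rw [pow_succ]
  field_simp

lemma bS_rec (s : ℝ) {β : ℝ} (hβ : -1/2 ≤ β) :
    PowerSeries.X * PowerSeries.derivative ℝ (bS s (β + 1)) + PowerSeries.C (β + 1) * bS s (β + 1)
      = bS s β := by
  ext n
  rw [map_add, PowerSeries.coeff_C_mul]
  have h2 : PowerSeries.coeff n (PowerSeries.X * PowerSeries.derivative ℝ (bS s (β + 1)))
      = n * PowerSeries.coeff n (bS s (β + 1)) := by
    cases n with
    | zero => simp
    | succ n => rw [PowerSeries.coeff_succ_X_mul, PowerSeries.coeff_derivative]; push_cast; ring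
  rw [h2, bS, bS, PowerSeries.coeff_mk, PowerSeries.coeff_mk]
  have hn : (0:ℝ) ≤ n := n.cast_nonneg
  have hg : β + 1 + (n:ℝ) + 1 = (β + n + 1) + 1 := by ring
  rw [hg, Real.Gamma_add_one (by linarith)]
  have hG := (gam_pos hβ n).ne'
  have hp : (β + n + 1) ≠ 0 := by linarith
  have hf : (n.factorial:ℝ) ≠ 0 := by positivity
  field_simp
  ring

lemma bF_rec {s β : ℝ} (hs : |s| = 1) (hβ : -1/2 ≤ β) (y : ℝ) :
    bF s β y = (β + 1) * bF s (β + 1) y + s * y * bF s (β + 2) y := by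
  have hb2 : β + 2 = β + 1 + 1 := by ring
  have s0 := (bF_summable hs hβ y).of_norm
  have s1 := (bF_summable hs (show -1/2 ≤ β + 1 by linarith) y).of_norm
  have s2 := (bF_summable hs (show -1/2 ≤ β + 1 + 1 by linarith) y).of_norm
  have h0 := s0.tsum_eq_zero_add
  have h1 := s1.tsum_eq_zero_add
  rw [hb2, bF, bF, bF, h0, h1, mul_add, ← tsum_mul_left, ← tsum_mul_left, add_assoc ((β + 1) * _),
    ← (((summable_nat_add_iff 1).2 s1).mul_left _).tsum_add (s2.mul_left _)]
  have hG := (gam_pos hβ 0)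
  congr 1
  · have : β + 1 ≠ 0 := by linarith
    simp only [Nat.cast_zero, add_zero, pow_zero, Nat.factorial_zero, Nat.cast_one, one_mul, mul_one]
      at hG ⊢
    rw [Real.Gamma_add_one this]
    field_simp
  · congr 1
    ext n
    have hn : (0:ℝ) ≤ n := n.cast_nonneg
    have hg : β + 1 + ((n + 1 : ℕ) :ℝ) + 1 = (β + (n + 1 : ℕ) + 1) + 1 := by ring
    have hg2 : β + 1 + 1 + (n:ℝ) + 1 = (β + (n + 1 : ℕ) + 1) + 1 := by push_cast; ring
    have hp : β + ((n + 1 : ℕ) : ℝ) + 1 ≠ 0 := by push_cast; linarith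
    rw [hg, hg2, Real.Gamma_add_one hp, Nat.factorial_succ]
    have hG := (gam_pos hβ (n+1)).ne'
    push_cast at hG hp ⊢
    have hf : (n.factorial:ℝ) ≠ 0 := by positivity
    have hn1 : (n:ℝ) + 1 ≠ 0 := by positivity
    field_simp
    ring

/-- Common form of the Bessel functions `J` (`s = -1`) and `I` (`s = 1`). -/
noncomputable def bB (s β x : ℝ) : ℝ := (x / 2) ^ β * bF s β ((x / 2) ^ 2)

lemma rpow_aux {x : ℝ} (hx : 0 < x) (ν : ℝ) (n : ℕ) :
    (x / 2) ^ (ν + 2 * (n : ℝ)) = (x / 2) ^ ν * ((x / 2) ^ 2) ^ n := by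
  rw [Real.rpow_add (by positivity), ← pow_mul, ← Real.rpow_natCast (x / 2) (2 * n)]
  push_cast
  rfl

lemma besselJ_eq {ν x : ℝ} (hx : 0 < x) : besselJ ν x = bB (-1) ν x := by
  rw [besselJ, bB, bF, ← tsum_mul_left]
  congr 1
  ext n
  rw [rpow_aux hx]
  ring

lemma besselI_eq {ν x : ℝ} (hx : 0 < x) : besselI ν x = bB 1 ν x := by
  rw [besselI, bB, bF, ← tsum_mul_left]
  congr 1
  ext n
  rw [rpow_aux hx, one_pow]
  ring

lemma rpow_half_succ {x : ℝ} (hx : 0 < x) (ν : ℝ) :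
    (x / 2) ^ (ν + 1) = (x / 2) ^ ν * (x / 2) := by
  rw [Real.rpow_add (by positivity), Real.rpow_one]

lemma bB_deriv1 {s ν x : ℝ} (hs : |s| = 1) (hν : -1/2 ≤ ν) (hx : 0 < x) :
    HasDerivAt (bB s ν) (ν / x * bB s ν x + s * bB s (ν + 1) x) x := by
  have h1 : HasDerivAt (fun t : ℝ => t / 2) (1 / 2) x := (hasDerivAt_id x).div_const 2
  have h2 := h1.rpow_const (p := ν) (Or.inl (by positivity))
  have h3 : HasDerivAt (fun t : ℝ => (t / 2) ^ 2) _ x := h1.pow 2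
  have h4 := (bF_hasDerivAt hs hν ((x / 2) ^ 2)).comp x h3
  refine (h2.mul h4).congr_deriv ?_
  simp only [bB, Function.comp_apply]
  rw [rpow_half_succ hx, Real.rpow_sub_one (by positivity)]
  field_simp
  push_cast
  ring

lemma bB_deriv2 {s ν x : ℝ} (hs : |s| = 1) (hν : -1/2 ≤ ν) (hx : 0 < x) :
    HasDerivAt (bB s (ν + 1)) (bB s ν x - (ν + 1) / x * bB s (ν + 1) x) x := by
  refine (bB_deriv1 hs (show -1/2 ≤ ν + 1 by linarith) hx).congr_deriv ?_
  simp only [bB]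
  rw [bF_rec hs hν, rpow_half_succ hx (ν + 1), rpow_half_succ hx ν,
    show ν + 1 + 1 = ν + 2 by ring]
  field_simp
  ring

lemma bB_lim {s ν : ℝ} (hs : |s| = 1) (hν : -1/2 ≤ ν) (β : ℝ) (hβ : 0 < β) :
    Filter.Tendsto (fun t : ℝ => (t / 2) ^ β * bF s ν ((t / 2) ^ 2)) (nhdsWithin 0 (Ioi 0))
      (nhds 0) := by
  have hc : Continuous (bF s ν) :=
    continuous_iff_continuousAt.2 fun y => (bF_hasDerivAt hs hν y).continuousAt
  have h1 : Continuous fun t : ℝ => (t / 2) ^ β :=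
    (continuous_id.div_const 2).rpow_const fun _ => Or.inr hβ.le
  have h2 : Continuous fun t : ℝ => (t / 2) ^ β * bF s ν ((t / 2) ^ 2) :=
    h1.mul (hc.comp (by fun_prop))
  have h3 := h2.tendsto 0
  simp only [zero_div, Real.zero_rpow hβ.ne', zero_mul] at h3
  exact h3.mono_left nhdsWithin_le_nhds

lemma bB_lim0 {s ν : ℝ} (hs : |s| = 1) (hν : -1/2 ≤ ν) :
    Filter.Tendsto (fun t : ℝ => t * bB s ν t) (nhdsWithin 0 (Ioi 0)) (nhds 0) := by
  have h := (bB_lim hs hν (ν + 1) (by linarith)).const_mul 2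
  rw [mul_zero] at h
  refine h.congr' ?_
  filter_upwards [self_mem_nhdsWithin] with t ht
  rw [bB, rpow_half_succ ht]
  ring

lemma bB_lim1 {s ν : ℝ} (hs : |s| = 1) (hν : -1/2 ≤ ν) :
    Filter.Tendsto (fun t : ℝ => bB s (ν + 1) t) (nhdsWithin 0 (Ioi 0)) (nhds 0) :=
  bB_lim hs (by linarith) (ν + 1) (by linarith)

lemma nonneg_of_int {N u : ℝ → ℝ} (hN : ∀ t, 0 < t → HasDerivAt N (t * u t ^ 2) t)
    (h0 : Filter.Tendsto N (nhdsWithin 0 (Ioi 0)) (nhds 0)) :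
    MonotoneOn N (Ioi 0) ∧ ∀ x, 0 < x → 0 ≤ N x := by
  have hm : MonotoneOn N (Ioi 0) := by
    refine monotoneOn_of_deriv_nonneg (convex_Ioi 0)
      (fun t ht => (hN t ht).continuousAt.continuousWithinAt)
      (fun t ht => ?_) (fun t ht => ?_)
    · rw [interior_Ioi] at ht
      exact (hN t ht).differentiableAt.differentiableWithinAt
    · rw [interior_Ioi] at ht
      rw [(hN t ht).deriv]
      have : (0:ℝ) < t := ht
      positivity
  refine ⟨hm, fun x hx => ?_⟩
  refine le_of_tendsto h0 ?_
  filter_upwards [Ioo_mem_nhdsGT hx] with t ht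
  exact hm ht.1 hx ht.2.le

lemma pos_of_int {N u : ℝ → ℝ} (hN : ∀ t, 0 < t → HasDerivAt N (t * u t ^ 2) t)
    (h0 : Filter.Tendsto N (nhdsWithin 0 (Ioi 0)) (nhds 0)) {x u' : ℝ} (hx : 0 < x)
    (hu : HasDerivAt u u' x) (hu' : u' ≠ 0) : 0 < N x := by
  obtain ⟨hm, hn⟩ := nonneg_of_int hN h0
  by_contra hneg
  have hz : ∀ t ∈ Ioc 0 x, N t = 0 := fun t ht =>
    le_antisymm ((hm ht.1 hx ht.2).trans (not_lt.1 hneg)) (hn t ht.1)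
  have hz2 : ∀ t ∈ Ioo 0 x, u t = 0 := by
    intro t ht
    have h1 : HasDerivAt N 0 t := (hasDerivAt_const t (0:ℝ)).congr_of_eventuallyEq (by
      filter_upwards [Ioo_mem_nhds ht.1 ht.2] with z hz'
      exact hz z ⟨hz'.1, hz'.2.le⟩)
    have h2 := (hN t ht.1).unique h1
    have : t ≠ 0 := ht.1.ne'
    simpa [this] using h2
  have hne : ∀ᶠ z in nhdsWithin x (Iio x), u z ≠ 0 :=
    (hu.eventually_ne hu').filter_mono (nhdsWithin_mono _ (fun z hz => ne_of_lt hz))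
  obtain ⟨t, ht1, ht2⟩ := (hne.and (Ioo_mem_nhdsLT hx)).exists
  exact ht1 (hz2 t ht2)

lemma crossW_eq {ν x : ℝ} (hx : 0 < x) : crossW ν x =
    bB (-1) (ν + 1) x * bB 1 ν x + bB (-1) ν x * bB 1 (ν + 1) x := by
  rw [crossW, besselJ_eq hx, besselI_eq hx, besselJ_eq hx, besselI_eq hx]

lemma E1_pos {ν x a b c d : ℝ} (hν : -1/2 ≤ ν) (hx : 0 < x)
    (ha : a = bB (-1) ν x) (hb : b = bB (-1) (ν + 1) x) (hc : c = bB 1 ν x)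
    (hd : d = bB 1 (ν + 1) x) (hW : b * c + a * d ≠ 0) :
    0 < c ^ 2 * (x ^ 2 / 2 * (a ^ 2 + b ^ 2) - ν * x * a * b)
      - c * a * (x * (b * c + a * d)) + a ^ 2 * (x ^ 2 / 2 * (c ^ 2 - d ^ 2) - ν * x * c * d) := by
  have hm : |(-1 : ℝ)| = 1 := by simp
  have ho : |(1 : ℝ)| = 1 := by simp
  have key := pos_of_int (x := x)
    (N := fun t => c ^ 2 * (t ^ 2 / 2 * (bB (-1) ν t ^ 2 + bB (-1) (ν + 1) t ^ 2)
        - ν * t * bB (-1) ν t * bB (-1) (ν + 1) t)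
      - c * a * (t * (bB (-1) (ν + 1) t * bB 1 ν t + bB (-1) ν t * bB 1 (ν + 1) t))
      + a ^ 2 * (t ^ 2 / 2 * (bB 1 ν t ^ 2 - bB 1 (ν + 1) t ^ 2)
        - ν * t * bB 1 ν t * bB 1 (ν + 1) t))
    (u := fun t => c * bB (-1) ν t - a * bB 1 ν t)
    (u' := c * (ν / x * bB (-1) ν x + (-1) * bB (-1) (ν + 1) x)
      - a * (ν / x * bB 1 ν x + 1 * bB 1 (ν + 1) x)) ?_ ?_ hx ?_ ?_
  · simpa only [← ha, ← hb, ← hc, ← hd] using key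
  · intro t ht
    have h1 := bB_deriv1 hm hν ht
    have h2 := bB_deriv2 hm hν ht
    have h3 := bB_deriv1 ho hν ht
    have h4 := bB_deriv2 ho hν ht
    have h0 := hasDerivAt_id' t
    have h5 := ((((h0.pow 2).div_const 2).mul ((h1.pow 2).add (h2.pow 2))).sub
      (((h0.const_mul ν).mul h1).mul h2)).const_mul (c ^ 2)
    have h6 := (h0.mul ((h2.mul h3).add (h1.mul h4))).const_mul (c * a)
    have h7 := ((((h0.pow 2).div_const 2).mul ((h3.pow 2).sub (h4.pow 2))).sub
      (((h0.const_mul ν).mul h3).mul h4)).const_mul (a ^ 2)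
    refine ((h5.sub h6).add h7).congr_deriv ?_
    simp only [Pi.add_apply, Pi.mul_apply, Pi.sub_apply, Pi.pow_apply]
    push_cast
    field_simp
    ring
  · have l1 := bB_lim0 hm hν
    have l2 := bB_lim1 hm hν
    have l3 := bB_lim0 ho hν
    have l4 := bB_lim1 ho hν
    have l0 : Filter.Tendsto (fun t : ℝ => t) (nhdsWithin 0 (Ioi 0)) (nhds 0) :=
      Filter.tendsto_id.mono_left nhdsWithin_le_nhds
    have h5 := ((((l1.pow 2).add ((l0.mul l2).pow 2)).div_const 2).sub
      ((l1.mul l2).const_mul ν)).const_mul (c ^ 2)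
    have h6 := ((l2.mul l3).add (l1.mul l4)).const_mul (c * a)
    have h7 := ((((l3.pow 2).sub ((l0.mul l4).pow 2)).div_const 2).sub
      ((l3.mul l4).const_mul ν)).const_mul (a ^ 2)
    have h8 := (h5.sub h6).add h7
    convert! h8 using 2
    · ring
    · ring
  · exact ((bB_deriv1 hm hν hx).const_mul c).sub ((bB_deriv1 ho hν hx).const_mul a)
  · rw [← ha, ← hb, ← hc, ← hd]
    intro h
    apply hW
    linarith

lemma E2_nonneg {ν x a b c d : ℝ} (hν : -1/2 ≤ ν) (hx : 0 < x)
    (ha : a = bB (-1) ν x) (hb : b = bB (-1) (ν + 1) x) (hc : c = bB 1 ν x)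
    (hd : d = bB 1 (ν + 1) x) :
    0 ≤ c ^ 2 * (x ^ 2 / 2 * (a ^ 2 + b ^ 2) - ν * x * a * b)
      + c * a * (x * (b * c + a * d)) + a ^ 2 * (x ^ 2 / 2 * (c ^ 2 - d ^ 2) - ν * x * c * d)
      - (2 * ν + 2) * (b * c + a * d) ^ 2 := by
  have hm : |(-1 : ℝ)| = 1 := by simp
  have ho : |(1 : ℝ)| = 1 := by simp
  have hν1 : 0 < ν + 1 := by linarith
  have hxp : 0 < x ^ (ν + 1) := Real.rpow_pos_of_pos hx _
  set C : ℝ := -((2 * ν + 2) * (b * c + a * d)) / x ^ (ν + 1) with hC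
  have key := (nonneg_of_int
    (N := fun t => c ^ 2 * (t ^ 2 / 2 * (bB (-1) ν t ^ 2 + bB (-1) (ν + 1) t ^ 2)
        - ν * t * bB (-1) ν t * bB (-1) (ν + 1) t)
      + c * a * (t * (bB (-1) (ν + 1) t * bB 1 ν t + bB (-1) ν t * bB 1 (ν + 1) t))
      + a ^ 2 * (t ^ 2 / 2 * (bB 1 ν t ^ 2 - bB 1 (ν + 1) t ^ 2)
        - ν * t * bB 1 ν t * bB 1 (ν + 1) t)
      + (2 * C) * (t ^ (ν + 1) * (c * bB (-1) (ν + 1) t + a * bB 1 (ν + 1) t))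
      + C ^ 2 / (2 * ν + 2) * (t ^ (ν + 1)) ^ 2)
    (u := fun t => c * bB (-1) ν t + a * bB 1 ν t + C * t ^ ν) ?_ ?_).2 x hx
  · simp only [← ha, ← hb, ← hc, ← hd] at key
    refine key.trans_eq ?_
    have : C * x ^ (ν + 1) = -((2 * ν + 2) * (b * c + a * d)) := by
      rw [hC]; field_simp
    have e1 : (2 * C) * (x ^ (ν + 1) * (c * b + a * d))
        = 2 * (C * x ^ (ν + 1)) * (c * b + a * d) := by ring
    have e2 : C ^ 2 / (2 * ν + 2) * (x ^ (ν + 1)) ^ 2 = (C * x ^ (ν + 1)) ^ 2 / (2 * ν + 2) := by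
      ring
    have hne : 2 * ν + 2 ≠ 0 := by linarith
    rw [e1, e2, this]
    field_simp
    ring
  · intro t ht
    have h1 := bB_deriv1 hm hν ht
    have h2 := bB_deriv2 hm hν ht
    have h3 := bB_deriv1 ho hν ht
    have h4 := bB_deriv2 ho hν ht
    have h0 := hasDerivAt_id' t
    have hr := h0.rpow_const (p := ν + 1) (Or.inl ht.ne')
    have h5 := ((((h0.pow 2).div_const 2).mul ((h1.pow 2).add (h2.pow 2))).sub
      (((h0.const_mul ν).mul h1).mul h2)).const_mul (c ^ 2)
    have h6 := (h0.mul ((h2.mul h3).add (h1.mul h4))).const_mul (c * a)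
    have h7 := ((((h0.pow 2).div_const 2).mul ((h3.pow 2).sub (h4.pow 2))).sub
      (((h0.const_mul ν).mul h3).mul h4)).const_mul (a ^ 2)
    have h8 := (hr.mul ((h2.const_mul c).add (h4.const_mul a))).const_mul (2 * C)
    have h9 := (hr.pow 2).const_mul (C ^ 2 / (2 * ν + 2))
    refine ((((h5.add h6).add h7).add h8).add h9).congr_deriv ?_
    simp only [Pi.add_apply, Pi.mul_apply, Pi.sub_apply, Pi.pow_apply]
    rw [show ν + 1 - 1 = ν by ring, Real.rpow_add ht, Real.rpow_one]
    have hne : 2 * ν + 2 ≠ 0 := by linarith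
    have hne' : ν + 1 ≠ 0 := by linarith
    push_cast
    rw [show 2 * ν + 2 = 2 * (ν + 1) by ring]
    clear_value C
    field_simp
    ring
  · have l1 := bB_lim0 hm hν
    have l2 := bB_lim1 hm hν
    have l3 := bB_lim0 ho hν
    have l4 := bB_lim1 ho hν
    have l0 : Filter.Tendsto (fun t : ℝ => t) (nhdsWithin 0 (Ioi 0)) (nhds 0) :=
      Filter.tendsto_id.mono_left nhdsWithin_le_nhds
    have lr : Filter.Tendsto (fun t : ℝ => t ^ (ν + 1)) (nhdsWithin 0 (Ioi 0)) (nhds 0) := by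
      have h1 : Continuous fun t : ℝ => t ^ (ν + 1) :=
        continuous_id.rpow_const fun _ => Or.inr hν1.le
      have h3 := h1.tendsto 0
      rw [Real.zero_rpow hν1.ne'] at h3
      exact h3.mono_left nhdsWithin_le_nhds
    have h5 := ((((l1.pow 2).add ((l0.mul l2).pow 2)).div_const 2).sub
      ((l1.mul l2).const_mul ν)).const_mul (c ^ 2)
    have h6 := ((l2.mul l3).add (l1.mul l4)).const_mul (c * a)
    have h7 := ((((l3.pow 2).sub ((l0.mul l4).pow 2)).div_const 2).sub
      ((l3.mul l4).const_mul ν)).const_mul (a ^ 2)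
    have h8 := (lr.mul ((l2.const_mul c).add (l4.const_mul a))).const_mul (2 * C)
    have h9 := (lr.pow 2).const_mul (C ^ 2 / (2 * ν + 2))
    have h10 := (((h5.add h6).add h7).add h8).add h9
    convert! h10 using 2
    · ring
    · ring

lemma main_neg {ν x : ℝ} (hν : -1/2 ≤ ν) (hx : 0 < x) (hW : crossW ν x ≠ 0) :
    deriv (deriv (fun t : ℝ => Real.log (crossW ν t))) x < 0 := by
  have hm : |(-1 : ℝ)| = 1 := by simp
  have ho : |(1 : ℝ)| = 1 := by simp
  set w : ℝ → ℝ := fun t => bB (-1) (ν + 1) t * bB 1 ν t + bB (-1) ν t * bB 1 (ν + 1) t with hw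
  have hwW : ∀ t, 0 < t → crossW ν t = w t := fun t ht => crossW_eq ht
  have hwd : ∀ t, 0 < t → HasDerivAt w (2 * (bB (-1) ν t * bB 1 ν t) - w t / t) t := by
    intro t ht
    refine (((bB_deriv2 hm hν ht).mul (bB_deriv1 ho hν ht)).add
      ((bB_deriv1 hm hν ht).mul (bB_deriv2 ho hν ht))).congr_deriv ?_
    simp only [hw]
    field_simp
    ring
  rw [hwW x hx] at hW
  have hev : ∀ᶠ t in nhds x, deriv (fun t : ℝ => Real.log (crossW ν t)) t =
      2 * (bB (-1) ν t * bB 1 ν t) / w t - t⁻¹ := by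
    filter_upwards [(hwd x hx).continuousAt.eventually_ne hW, Ioi_mem_nhds hx] with t ht1 ht2
    have ht0 : t ≠ 0 := ne_of_gt ht2
    have h1 := (hwd t ht2).log ht1
    have h2 : HasDerivAt (fun t : ℝ => Real.log (crossW ν t)) _ t := h1.congr_of_eventuallyEq (by
      filter_upwards [Ioi_mem_nhds ht2] with z hz
      rw [hwW z hz])
    rw [h2.deriv]
    field_simp
  rw [Filter.EventuallyEq.deriv_eq hev]
  have hP := (((bB_deriv1 hm hν hx).mul (bB_deriv1 ho hν hx)).const_mul 2)
  have hT := (hP.div (hwd x hx) hW).sub (hasDerivAt_inv hx.ne')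
  have hT' := hT.deriv
  refine (Eq.trans_lt hT' ?_)
  have hWe : w x = bB (-1) (ν + 1) x * bB 1 ν x + bB (-1) ν x * bB 1 (ν + 1) x := rfl
  have e1 := E1_pos hν hx rfl rfl rfl rfl (hWe ▸ hW)
  have e2 := E2_nonneg hν hx (a := bB (-1) ν x) (c := bB 1 ν x) rfl rfl rfl rfl
  simp only [Pi.mul_apply]
  clear_value w
  generalize bB (-1) ν x = a at *
  generalize bB (-1) (ν + 1) x = b at *
  generalize bB 1 ν x = c at *
  generalize bB 1 (ν + 1) x = d at *
  have hpos : 0 < x ^ 2 * w x ^ 2 := by positivity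
  have h2 : 0 ≤ (2 * ν + 1) * w x ^ 2 := mul_nonneg (by linarith) (sq_nonneg _)
  refine neg_of_mul_neg_right (b := _) (a := x ^ 2 * w x ^ 2) ?_ hpos.le
  refine lt_of_eq_of_lt (b := -3 * (c ^ 2 * (x ^ 2 / 2 * (a ^ 2 + b ^ 2) - ν * x * a * b)
      - c * a * (x * (b * c + a * d)) + a ^ 2 * (x ^ 2 / 2 * (c ^ 2 - d ^ 2) - ν * x * c * d))
      - (c ^ 2 * (x ^ 2 / 2 * (a ^ 2 + b ^ 2) - ν * x * a * b)
      + c * a * (x * (b * c + a * d)) + a ^ 2 * (x ^ 2 / 2 * (c ^ 2 - d ^ 2) - ν * x * c * d)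
      - (2 * ν + 2) * (b * c + a * d) ^ 2) - (2 * ν + 1) * w x ^ 2) ?_ (by linarith)
  field_simp
  rw [hWe]
  ring

lemma coeff_X_mul_deriv (f : PowerSeries ℝ) (n : ℕ) :
    PowerSeries.coeff n (PowerSeries.X * PowerSeries.derivative ℝ f)
      = n * PowerSeries.coeff n f := by
  cases n with
  | zero => simp
  | succ n => rw [PowerSeries.coeff_succ_X_mul, PowerSeries.coeff_derivative]; push_cast; ring

/-- The formal power series of the cross-product. -/
noncomputable def wS (ν : ℝ) : PowerSeries ℝ :=
  bS (-1) (ν + 1) * bS 1 ν + bS (-1) ν * bS 1 (ν + 1)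

lemma wS_rec {ν : ℝ} (hν : -1/2 ≤ ν) :
    PowerSeries.coeff 1 (wS ν) = 0 ∧
    ∀ n : ℕ, PowerSeries.coeff (n + 2) (wS ν) * ((n + 2) * (n + ν + 3) * (n + ν + 2) *
      (n + 2 * ν + 2)) = -4 * PowerSeries.coeff n (wS ν) := by
  set A := bS (-1) ν with hA
  set B := bS (-1) (ν + 1) with hB
  set C := bS 1 ν with hC
  set D := bS 1 (ν + 1) with hD
  set K : PowerSeries ℝ := PowerSeries.C (ν + 1) with hK
  have a1 : PowerSeries.derivative ℝ A = -B := by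
    rw [hA, bS_deriv]; simp [hB]
  have c1 : PowerSeries.derivative ℝ C = D := by
    rw [hC, bS_deriv]; simp [hD]
  have b1 : PowerSeries.X * PowerSeries.derivative ℝ B + K * B = A := bS_rec _ hν
  have d1 : PowerSeries.X * PowerSeries.derivative ℝ D + K * D = C := bS_rec _ hν
  have hP : PowerSeries.derivative ℝ (A * C) = A * D - B * C := by
    rw [Derivation.leibniz, a1, c1, smul_eq_mul, smul_eq_mul]; ring
  have hW : PowerSeries.X * PowerSeries.derivative ℝ (wS ν) + K * wS ν = PowerSeries.C 2 * (A * C) := by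
    rw [wS, map_add, Derivation.leibniz, Derivation.leibniz, a1, c1]
    simp only [smul_eq_mul]
    rw [show (PowerSeries.C 2 : PowerSeries ℝ) = 2 from map_ofNat _ 2]
    linear_combination C * b1 + A * d1
  have hQ : PowerSeries.X * PowerSeries.derivative ℝ (A * D - B * C) + K * (A * D - B * C)
      = PowerSeries.X * (PowerSeries.C (-2) * (B * D)) := by
    rw [map_sub, Derivation.leibniz, Derivation.leibniz, a1, c1]
    simp only [smul_eq_mul]
    rw [show (PowerSeries.C (-2) : PowerSeries ℝ) = -2 by rw [map_neg]; rw [map_ofNat]]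
    linear_combination A * d1 - C * b1
  have hR : PowerSeries.X * PowerSeries.derivative ℝ (B * D) + PowerSeries.C 2 * (K * (B * D))
      = wS ν := by
    rw [wS, Derivation.leibniz]
    simp only [smul_eq_mul]
    rw [show (PowerSeries.C 2 : PowerSeries ℝ) = 2 from map_ofNat _ 2]
    linear_combination D * b1 + B * d1
  have hP' : ∀ n : ℕ, PowerSeries.coeff (n + 1) (A * C) * (n + 1)
      = PowerSeries.coeff n (A * D - B * C) := fun n => by
    rw [← hP, PowerSeries.coeff_derivative]
  have hW' : ∀ n : ℕ, (n + ν + 1) * PowerSeries.coeff n (wS ν)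
      = 2 * PowerSeries.coeff n (A * C) := fun n => by
    have := congrArg (PowerSeries.coeff n) hW
    rw [map_add, coeff_X_mul_deriv, PowerSeries.coeff_C_mul, PowerSeries.coeff_C_mul] at this
    linarith
  have hQ' : ∀ n : ℕ, ((n + 1 : ℕ) + ν + 1) * PowerSeries.coeff (n + 1) (A * D - B * C)
      = -2 * PowerSeries.coeff n (B * D) := fun n => by
    have := congrArg (PowerSeries.coeff (n + 1)) hQ
    rw [map_add, coeff_X_mul_deriv, PowerSeries.coeff_C_mul, PowerSeries.coeff_succ_X_mul,
      PowerSeries.coeff_C_mul] at this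
    linarith
  have hQ0 : (ν + 1) * PowerSeries.coeff 0 (A * D - B * C) = 0 := by
    have := congrArg (PowerSeries.coeff 0) hQ
    rw [map_add, coeff_X_mul_deriv, PowerSeries.coeff_C_mul, PowerSeries.coeff_zero_X_mul,
      Nat.cast_zero, zero_mul, zero_add] at this
    exact this
  have hR' : ∀ n : ℕ, (n + 2 * ν + 2) * PowerSeries.coeff n (B * D)
      = PowerSeries.coeff n (wS ν) := fun n => by
    have := congrArg (PowerSeries.coeff n) hR
    rw [map_add, coeff_X_mul_deriv, PowerSeries.coeff_C_mul, PowerSeries.coeff_C_mul] at this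
    linarith
  constructor
  · have h0 : PowerSeries.coeff 0 (A * D - B * C) = 0 := by
      rcases mul_eq_zero.1 hQ0 with h | h
      · linarith
      · exact h
    have h1 := hP' 0
    have h2 := hW' 1
    rw [h0] at h1
    simp only [Nat.cast_zero, zero_add, mul_one, Nat.cast_one] at h1 h2
    rw [h1, mul_zero] at h2
    rcases mul_eq_zero.1 h2 with h | h
    · linarith
    · exact h
  · intro n
    have h1 := hW' (n + 2)
    have h2 := hP' (n + 1)
    have h3 := hQ' n
    have h4 := hR' n
    push_cast at h1 h2 h3
    generalize PowerSeries.coeff (n + 1) (A * D - B * C) = q at *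
    rw [show n + 1 + 1 = n + 2 from rfl] at h2
    linear_combination (n + 2 : ℝ) * (n + ν + 2) * (n + 2 * ν + 2) * h1
      + 2 * (n + ν + 2) * (n + 2 * ν + 2) * h2 + 2 * (n + 2 * ν + 2) * h3 - 4 * h4

lemma wS_odd {ν : ℝ} (hν : -1/2 ≤ ν) (m : ℕ) : PowerSeries.coeff (2 * m + 1) (wS ν) = 0 := by
  induction m with
  | zero => exact (wS_rec hν).1
  | succ m ih =>
    have h := (wS_rec hν).2 (2 * m + 1)
    rw [ih, mul_zero] at h
    rw [show 2 * (m + 1) + 1 = 2 * m + 1 + 2 by ring]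
    have hm : (0:ℝ) ≤ m := m.cast_nonneg
    refine (mul_eq_zero.1 h).resolve_right ?_
    push_cast
    have e1 : 0 < 2 * (m:ℝ) + 1 + 2 := by linarith
    have e2 : 0 < 2 * (m:ℝ) + 1 + ν + 3 := by linarith
    have e3 : 0 < 2 * (m:ℝ) + 1 + ν + 2 := by linarith
    have e4 : 0 < 2 * (m:ℝ) + 1 + 2 * ν + 2 := by linarith
    positivity

lemma wS_even {ν : ℝ} (hν : -1/2 ≤ ν) (m : ℕ) : PowerSeries.coeff (2 * m) (wS ν) =
    2 * (-1) ^ m / ((m.factorial : ℝ) * Real.Gamma (ν + m + 1) * Real.Gamma (ν + 2 * m + 2)) := by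
  induction m with
  | zero =>
    rw [wS, map_add, mul_zero, PowerSeries.coeff_mul, PowerSeries.coeff_mul,
      Finset.Nat.antidiagonal_zero, Finset.sum_singleton, Finset.sum_singleton]
    simp only [bS, PowerSeries.coeff_mk, pow_zero, Nat.factorial_zero, Nat.cast_one, Nat.cast_zero,
      add_zero, one_mul, mul_one, mul_zero]
    rw [show ν + 1 + 1 = ν + 2 by ring]
    ring
  | succ m ih =>
    have h := (wS_rec hν).2 (2 * m)
    rw [ih] at h
    rw [show 2 * (m + 1) = 2 * m + 2 by ring]
    have hm : (0:ℝ) ≤ m := m.cast_nonneg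
    have e0 : 0 < (m:ℝ) + 1 := by linarith
    have e1 : 0 < ν + m + 1 := by linarith
    have e2 : 0 < ν + 2 * (m:ℝ) + 2 := by linarith
    have e3 : 0 < ν + 2 * (m:ℝ) + 2 + 1 := by linarith
    have g1 := Real.Gamma_pos_of_pos e1
    have g2 := Real.Gamma_pos_of_pos e2
    have hf : (0:ℝ) < m.factorial := by exact_mod_cast m.factorial_pos
    rw [show ν + ((m + 1 : ℕ) : ℝ) + 1 = ν + m + 1 + 1 by push_cast; ring,
      show ν + 2 * ((m + 1 : ℕ) : ℝ) + 2 = ν + 2 * m + 2 + 1 + 1 by push_cast; ring,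
      Real.Gamma_add_one e1.ne', Real.Gamma_add_one e3.ne', Real.Gamma_add_one e2.ne',
      Nat.factorial_succ, pow_succ]
    push_cast at h ⊢
    have hk : 0 < 4 * ((m + 1 : ℝ) * (ν + m + 1) * (ν + 2 * m + 2 + 1) * (ν + 2 * m + 2)) := by
      positivity
    apply mul_right_cancel₀ hk.ne'
    trans (-4 * (2 * (-1) ^ m / (m.factorial * Real.Gamma (ν + m + 1) * Real.Gamma (ν + 2 * m + 2))))
    · rw [← h]; ring
    · field_simp

lemma bF_mul {s s' β β' : ℝ} (hs : |s| = 1) (hs' : |s'| = 1) (hβ : -1/2 ≤ β) (hβ' : -1/2 ≤ β')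
    (y : ℝ) : HasSum (fun n => PowerSeries.coeff n (bS s β * bS s' β') * y ^ n)
      (bF s β y * bF s' β' y) := by
  have h1 := bF_summable hs hβ y
  have h2 := bF_summable hs' hβ' y
  have h3 := (summable_norm_sum_mul_antidiagonal_of_summable_norm h1 h2).of_norm.hasSum
  rw [← tsum_mul_tsum_eq_tsum_sum_antidiagonal_of_summable_norm h1 h2] at h3
  have e : (fun n => PowerSeries.coeff n (bS s β * bS s' β') * y ^ n) = fun n : ℕ =>
      ∑ kl ∈ Finset.HasAntidiagonal.antidiagonal n,
        s ^ kl.1 / ((kl.1.factorial : ℝ) * Real.Gamma (β + kl.1 + 1)) * y ^ kl.1 *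
        (s' ^ kl.2 / ((kl.2.factorial : ℝ) * Real.Gamma (β' + kl.2 + 1)) * y ^ kl.2) := by
    ext n
    rw [PowerSeries.coeff_mul, Finset.sum_mul]
    refine Finset.sum_congr rfl fun kl hkl => ?_
    rw [← Finset.HasAntidiagonal.mem_antidiagonal.1 hkl, bS, bS, PowerSeries.coeff_mk, PowerSeries.coeff_mk,
      pow_add]
    ring
  rw [e]
  exact h3

lemma Wcal_eq_s3 {ν x : ℝ} (hν : -1/2 ≤ ν) (hx : 0 < x) :
    crossW ν x = (x / 2) ^ ν * (x / 2) ^ (ν + 1) *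
      (2 / (Real.Gamma (ν + 1) * Real.Gamma (ν + 2)) * Wcal ν x) := by
  have hm : |(-1 : ℝ)| = 1 := by simp
  have ho : |(1 : ℝ)| = 1 := by simp
  have hν1 : -1/2 ≤ ν + 1 := by linarith
  set y := (x / 2) ^ 2 with hy
  have h := (bF_mul hm ho hν1 hν y).add (bF_mul hm ho hν hν1 y)
  have h' : HasSum (fun n => PowerSeries.coeff n (wS ν) * y ^ n)
      (bF (-1) (ν + 1) y * bF 1 ν y + bF (-1) ν y * bF 1 (ν + 1) y) := by
    have e : (fun n => PowerSeries.coeff n (wS ν) * y ^ n) = fun n : ℕ =>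
        PowerSeries.coeff n (bS (-1) (ν + 1) * bS 1 ν) * y ^ n +
        PowerSeries.coeff n (bS (-1) ν * bS 1 (ν + 1)) * y ^ n := by
      ext n
      rw [wS, map_add, add_mul]
    rw [e]
    exact h
  have g1 := Real.Gamma_pos_of_pos (show 0 < ν + 1 by linarith)
  have g2 := Real.Gamma_pos_of_pos (show 0 < ν + 2 by linarith)
  have hinj : Function.Injective (fun m : ℕ => 2 * m) := fun a b h => by simpa using h
  have h2 := h'.tsum_eq
  rw [← hinj.tsum_eq (by
    intro n hn
    rcases Nat.even_or_odd' n with ⟨k, hk | hk⟩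
    · exact ⟨k, hk.symm⟩
    · exfalso
      apply hn
      simp only [hk, wS_odd hν, zero_mul])] at h2
  have h3 : 2 / (Real.Gamma (ν + 1) * Real.Gamma (ν + 2)) * Wcal ν x =
      bF (-1) (ν + 1) y * bF 1 ν y + bF (-1) ν y * bF 1 (ν + 1) y := by
    rw [← h2, Wcal, ← tsum_mul_left]
    congr 1
    ext m
    simp only [wS_even hν]
    rw [hy, ← pow_mul, show 2 * (2 * m) = 4 * m by ring, div_pow]
    field_simp
  rw [h3, crossW_eq hx]
  simp only [bB, ← hy]
  ring

/-- For `ν ≥ -1/2`, the cross-product `W_ν` is strictly log-concave on the set of positive `x`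
where `𝒲_ν` is positive. -/
theorem crossW_strict_logConcave (ν : ℝ) (hν : -1/2 ≤ ν) :
    ∀ x : ℝ, 0 < x → 0 < Wcal ν x →
      deriv (deriv (fun t : ℝ => Real.log (crossW ν t))) x < 0 := by
  intro x hx hW
  apply main_neg hν hx
  rw [Wcal_eq_s3 hν hx]
  have g1 := Real.Gamma_pos_of_pos (show 0 < ν + 1 by linarith)
  have g2 := Real.Gamma_pos_of_pos (show 0 < ν + 2 by linarith)
  positivity
end

section
/- Let ν > -1 and let γ_{ν,1} be the smallest positive zero of 𝒲_ν. Then the function x ↦ -d/dx[log 𝒲_ν(x^{1/4})] and the function x ↦ 1/𝒲_ν(x^{1/4}) are both absolutely monotonic on the interval (0, γ_{ν,1}⁴). -/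
open Real Set

section Algebra
open scoped ComplexOrder
open Polynomial

/-- Polynomials all of whose complex roots are positive reals. -/
def PosRooted (P : ℂ[X]) : Prop := ∀ z : ℂ, P.eval z = 0 → 0 < z

lemma PosRooted.logDeriv {P : ℂ[X]} (hP : PosRooted P) :
    ∃ S : PowerSeries ℂ, (∀ n, 0 ≤ PowerSeries.coeff n S) ∧
      S * (P : PowerSeries ℂ) = - PowerSeries.derivative ℂ (P : PowerSeries ℂ) := by
  have h0 : P ≠ 0 := by
    rintro rfl
    exact lt_irrefl _ (hP 0 (by simp))
  have key : ∀ m : Multiset ℂ, (∀ z ∈ m, 0 < z) → ∃ S : PowerSeries ℂ,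
      (∀ n, 0 ≤ PowerSeries.coeff n S) ∧
      S * (((m.map fun a => X - C a).prod : ℂ[X]) : PowerSeries ℂ) =
        - PowerSeries.derivative ℂ (((m.map fun a => X - C a).prod : ℂ[X]) : PowerSeries ℂ) := by
    intro m
    induction m using Multiset.induction_on with
    | empty =>
      intro _
      exact ⟨0, by simp, by simp⟩
    | cons r m ih =>
      intro h
      obtain ⟨S, hS, hSm⟩ := ih (fun z hz => h z (Multiset.mem_cons_of_mem hz))
      have hr : 0 < r := h r (Multiset.mem_cons_self _ _)
      have hrinv : 0 ≤ r⁻¹ := inv_nonneg.mpr hr.le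
      set T : PowerSeries ℂ := PowerSeries.mk fun n => r⁻¹ ^ (n+1) with hT
      have hT1 : T * (PowerSeries.X - PowerSeries.C r) = -1 := by
        ext n
        rw [mul_sub]
        cases n with
        | zero => simp [hT, hr.ne']
        | succ n =>
          simp only [map_sub, map_neg, PowerSeries.coeff_succ_mul_X, PowerSeries.coeff_mul_C, hT,
            PowerSeries.coeff_mk, PowerSeries.coeff_one]
          have := hr.ne'
          simp
          field_simp
          ring
      refine ⟨T + S, fun n => ?_, ?_⟩
      · rw [map_add]
        refine add_nonneg ?_ (hS n)
        simp only [hT, PowerSeries.coeff_mk]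
        exact pow_nonneg hrinv _
      · rw [Multiset.map_cons, Multiset.prod_cons, Polynomial.coe_mul, Derivation.leibniz]
        simp only [Polynomial.coe_sub, Polynomial.coe_X, Polynomial.coe_C, map_sub,
          PowerSeries.derivative_X, PowerSeries.derivative_C, smul_eq_mul]
        linear_combination (((m.map fun a => X - C a).prod : ℂ[X]) : PowerSeries ℂ) * hT1 +
          (PowerSeries.X - PowerSeries.C r) * hSm
  obtain ⟨S, hS, hSm⟩ := key P.roots (fun z hz => hP z (by simpa using (Polynomial.mem_roots h0).1 hz))
  refine ⟨S, hS, ?_⟩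
  have hsp := (IsAlgClosed.splits P).eq_prod_roots
  rw [hsp, Polynomial.coe_mul, Derivation.leibniz]
  simp only [Polynomial.coe_C, PowerSeries.derivative_C, smul_eq_mul]
  linear_combination (PowerSeries.C P.leadingCoeff) * hSm

/-- the operator `1 + θ/c` -/
noncomputable def thetaOp (c : ℝ) (P : ℂ[X]) : ℂ[X] := P + C (c⁻¹ : ℂ) * (X * derivative P)

lemma thetaOp_coeff (c : ℝ) (P : ℂ[X]) (k : ℕ) :
    (thetaOp c P).coeff k = (1 + k / c) * P.coeff k := by
  rw [thetaOp, coeff_add, coeff_C_mul]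
  cases k with
  | zero => simp
  | succ k =>
    rw [coeff_X_mul, coeff_derivative]
    push_cast
    ring

lemma PosRooted.thetaOp {P : ℂ[X]} (hP : PosRooted P) {c : ℝ} (hc : 0 < c) :
    PosRooted (thetaOp c P) := by
  intro z hz
  by_cases hPz : P.eval z = 0
  · exact hP z hPz
  by_contra hzpos
  have hP0 : P ≠ 0 := by rintro rfl; simp at hPz
  have hcC : (c : ℂ) ≠ 0 := by exact_mod_cast hc.ne'
  simp only [_root_.thetaOp, eval_add, eval_mul, eval_C, eval_X] at hz
  have hz0 : z ≠ 0 := by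
    rintro rfl
    simp at hz
    exact hPz hz
  have h1 := (IsAlgClosed.splits P).eval_derivative_div_eval_of_ne_zero hPz
  have h2 : z * (P.roots.map fun a => 1 / (z - a)).sum = -c := by
    rw [← h1]
    field_simp at hz ⊢
    linear_combination hz
  rw [← Multiset.sum_map_mul_left] at h2
  have hroots : ∀ a ∈ P.roots, 0 < a :=
    fun a ha => hP a (by simpa using (Polynomial.mem_roots hP0).1 ha)
  have hne : ∀ a ∈ P.roots, z - a ≠ 0 := by
    intro a ha h
    have : z = a := by linear_combination h
    exact hPz (by rw [this]; simpa using (Polynomial.mem_roots hP0).1 ha)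
  -- imaginary parts
  have him : (P.roots.map fun a => (z * (1 / (z - a))).im).sum = 0 := by
    have := congrArg Complex.imAddGroupHom h2
    rw [map_multiset_sum] at this
    simpa [Multiset.map_map, Function.comp_def] using this
  have hre : (P.roots.map fun a => (z * (1 / (z - a))).re).sum = -c := by
    have := congrArg Complex.reAddGroupHom h2
    rw [map_multiset_sum] at this
    simpa [Multiset.map_map, Function.comp_def] using this
  have imf : ∀ a ∈ P.roots, (z * (1 / (z - a))).im = - z.im * (a.re / Complex.normSq (z - a)) := by
    intro a ha
    obtain ⟨h1, h2⟩ := Complex.pos_iff.1 (hroots a ha)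
    rw [one_div, Complex.mul_im, Complex.inv_re, Complex.inv_im]
    simp only [Complex.sub_re, Complex.sub_im, ← h2]
    ring
  rw [Multiset.map_congr rfl imf, Multiset.sum_map_mul_left] at him
  have hpos : ∀ a ∈ P.roots, 0 < a.re / Complex.normSq (z - a) := by
    intro a ha
    exact div_pos (Complex.pos_iff.1 (hroots a ha)).1 (Complex.normSq_pos.2 (hne a ha))
  have hr0 : P.roots ≠ 0 := by
    intro h
    rw [h] at hre
    simp at hre
    exact hc.ne' hre
  have hsum : 0 < (P.roots.map fun a => a.re / Complex.normSq (z - a)).sum := by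
    obtain ⟨a, ha⟩ := Multiset.exists_mem_of_ne_zero hr0
    obtain ⟨t, ht⟩ := Multiset.exists_cons_of_mem ha
    rw [ht, Multiset.map_cons, Multiset.sum_cons]
    refine add_pos_of_pos_of_nonneg (hpos a ha) (Multiset.sum_nonneg ?_)
    intro x hx
    obtain ⟨b, hb, rfl⟩ := Multiset.mem_map.1 hx
    exact (hpos b (ht ▸ Multiset.mem_cons_of_mem hb)).le
  have hzim : z.im = 0 := by
    rcases mul_eq_zero.1 him with h | h
    · linarith
    · exact absurd h hsum.ne'
  by_cases hzre : 0 < z.re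
  · exact hzpos (Complex.pos_iff.2 ⟨hzre, hzim.symm⟩)
  · have : 0 ≤ (P.roots.map fun a => (z * (1 / (z - a))).re).sum := by
      refine Multiset.sum_nonneg ?_
      intro x hx
      obtain ⟨b, hb, rfl⟩ := Multiset.mem_map.1 hx
      obtain ⟨h1, h2⟩ := Complex.pos_iff.1 (hroots b hb)
      have hns := Complex.normSq_pos.2 (hne b hb)
      rw [one_div, Complex.mul_re, Complex.inv_re, Complex.inv_im, hzim, Complex.sub_re]
      rw [zero_mul, sub_zero, ← mul_div_assoc]
      apply div_nonneg _ hns.le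
      nlinarith
    linarith

open Filter Topology

/-- limits of logarithmic derivatives -/
lemma tendsto_logDeriv (F S : ℕ → PowerSeries ℂ) (G T : PowerSeries ℂ)
    (hF : ∀ k, Tendsto (fun N => PowerSeries.coeff k (F N)) atTop (𝓝 (PowerSeries.coeff k G)))
    (hF0 : ∀ N, PowerSeries.coeff 0 (F N) = 1) (hG0 : PowerSeries.coeff 0 G = 1)
    (hS : ∀ N, S N * F N = - PowerSeries.derivative ℂ (F N))
    (hT : T * G = - PowerSeries.derivative ℂ G) (n : ℕ) :
    Tendsto (fun N => PowerSeries.coeff n (S N)) atTop (𝓝 (PowerSeries.coeff n T)) := by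
  have hrec : ∀ (A B : PowerSeries ℂ), PowerSeries.coeff 0 A = 1 →
      B * A = - PowerSeries.derivative ℂ A → ∀ n, PowerSeries.coeff n B =
        - (PowerSeries.coeff (n+1) A * (n+1)) -
          ∑ i ∈ Finset.range n, PowerSeries.coeff i B * PowerSeries.coeff (n - i) A := by
    intro A B hA hB n
    have := congrArg (PowerSeries.coeff n) hB
    rw [PowerSeries.coeff_mul, map_neg, PowerSeries.coeff_derivative,
      Finset.Nat.sum_antidiagonal_eq_sum_range_succ
        (fun i j => PowerSeries.coeff i B * PowerSeries.coeff j A), Finset.sum_range_succ,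
      Nat.sub_self, hA, mul_one] at this
    linear_combination this
  induction n using Nat.strong_induction_on with
  | _ n ih =>
    rw [hrec G T hG0 hT n]
    simp_rw [fun N => hrec (F N) (S N) (hF0 N) (hS N) n]
    refine Tendsto.sub ((hF _).mul_const _).neg (tendsto_finsetSum _ fun i hi => ?_)
    exact (ih i (Finset.mem_range.1 hi)).mul (hF _)

/-- iterated theta operators -/
noncomputable def thetaIter (b : ℝ) (P : ℂ[X]) : ℕ → ℂ[X]
  | 0 => P
  | n+1 => thetaOp (b + n) (thetaIter b P n)

lemma thetaIter_posRooted {b : ℝ} (hb : 0 < b) {P : ℂ[X]} (hP : PosRooted P) (n : ℕ) :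
    PosRooted (thetaIter b P n) := by
  induction n with
  | zero => exact hP
  | succ n ih => exact ih.thetaOp (by positivity)

lemma thetaIter_coeff {b : ℝ} (hb : 0 < b) (P : ℂ[X]) (n k : ℕ) :
    (thetaIter b P n).coeff k =
      ((∏ j ∈ Finset.range k, (1 + n / (b + j)) : ℝ) : ℂ) * P.coeff k := by
  induction n with
  | zero => simp [thetaIter]
  | succ n ih =>
    rw [thetaIter, thetaOp_coeff, ih, ← mul_assoc]
    congr 1
    have key : (1 + k / (b + n)) * (∏ j ∈ Finset.range k, (1 + n / (b + j)) : ℝ) =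
        ∏ j ∈ Finset.range k, (1 + ((n + 1 : ℕ) : ℝ) / (b + j)) := by
      have e : ∀ m : ℕ, (∏ j ∈ Finset.range k, (1 + (m:ℝ) / (b + j)) : ℝ) =
          (∏ j ∈ Finset.range k, (b + m + j)) / ∏ j ∈ Finset.range k, (b + j) := by
        intro m
        rw [← Finset.prod_div_distrib]
        refine Finset.prod_congr rfl fun j _ => ?_
        have : b + j ≠ 0 := by positivity
        field_simp
        ring
      rw [e, e, ← mul_div_assoc]
      congr 1
      have h1 := Finset.prod_range_succ (fun j : ℕ => b + n + (j:ℝ)) k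
      have h2 := Finset.prod_range_succ' (fun j : ℕ => b + n + (j:ℝ)) k
      have h3 : ∏ j ∈ Finset.range k, (b + n + ((j + 1 : ℕ) : ℝ)) =
          ∏ j ∈ Finset.range k, (b + ((n + 1 : ℕ) : ℝ) + j) := by
        refine Finset.prod_congr rfl fun j _ => ?_
        push_cast
        ring
      rw [h3] at h2
      have hbn : b + n ≠ 0 := by positivity
      rw [h1] at h2
      simp only [Nat.cast_zero, add_zero] at h2
      field_simp
      linear_combination h2
    rw [← key]
    push_cast
    ring

lemma tendsto_mult {b : ℝ} (k : ℕ) :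
    Tendsto (fun n : ℕ => (∏ j ∈ Finset.range k, (1 + ((n + 1 : ℕ) : ℝ) / (b + j)) : ℝ) /
      ((n + 1 : ℕ) : ℝ) ^ k) atTop (𝓝 (∏ j ∈ Finset.range k, (b + j)⁻¹)) := by
  have h : ∀ n : ℕ, (∏ j ∈ Finset.range k, (1 + ((n + 1 : ℕ) : ℝ) / (b + j)) : ℝ) /
      ((n + 1 : ℕ) : ℝ) ^ k = ∏ j ∈ Finset.range k, (1 / ((n : ℝ) + 1) + (b + j)⁻¹) := by
    intro n
    have : ((n + 1 : ℕ) : ℝ) ^ k = ∏ j ∈ Finset.range k, ((n + 1 : ℕ) : ℝ) := by simp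
    rw [this, ← Finset.prod_div_distrib]
    refine Finset.prod_congr rfl fun j _ => ?_
    have : (n : ℝ) + 1 ≠ 0 := by positivity
    push_cast
    field_simp
  simp_rw [h]
  refine tendsto_finsetProd _ fun j _ => ?_
  simpa using (tendsto_one_div_add_atTop_nhds_zero_nat (𝕜 := ℝ)).add_const ((b + j)⁻¹)

lemma tendsto_choose (k : ℕ) :
    Tendsto (fun n : ℕ => ((n + 1).choose k : ℝ) / ((n + 1 : ℕ) : ℝ) ^ k) atTop
      (𝓝 (1 / (k.factorial : ℝ))) := by
  have h : Tendsto (fun n : ℕ => (n : ℝ) * (1 / (n : ℝ))) atTop (𝓝 1) := by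
    refine tendsto_const_nhds.congr' ?_
    filter_upwards [eventually_gt_atTop 0] with n hn
    have : (n : ℝ) ≠ 0 := by positivity
    field_simp
  have h2 := (ProbabilityTheory.tendsto_choose_mul_pow_atTop k h).comp (tendsto_add_atTop_nat 1)
  rw [one_pow] at h2
  refine h2.congr fun n => ?_
  simp only [Function.comp, one_div, inv_pow]
  rw [div_eq_mul_inv]

noncomputable def basePoly (n : ℕ) : ℂ[X] :=
  (1 - C (((1 / (64 * ((n + 1 : ℕ) : ℝ) ^ 4) : ℝ)) : ℂ) * X) ^ (n + 1)

lemma basePoly_posRooted (n : ℕ) : PosRooted (basePoly n) := by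
  intro z hz
  have h1 : 1 - (((1 / (64 * ((n + 1 : ℕ) : ℝ) ^ 4) : ℝ)) : ℂ) * z = 0 := by
    simpa [basePoly] using hz
  have h2 : z = ((64 * ((n + 1 : ℕ) : ℝ) ^ 4 : ℝ) : ℂ) := by
    have : ((n : ℂ) + 1) ≠ 0 := by exact_mod_cast Nat.succ_ne_zero n
    push_cast at h1 ⊢
    field_simp at h1
    linear_combination -h1
  rw [h2]
  rw [Complex.zero_lt_real]
  positivity

lemma basePoly_coeff (n k : ℕ) : (basePoly n).coeff k =
    (((n + 1).choose k * (- (1 / (64 * ((n + 1 : ℕ) : ℝ) ^ 4))) ^ k : ℝ) : ℂ) := by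
  have : basePoly n = ((1 + X) ^ (n+1)).comp
      (C (((-(1 / (64 * ((n + 1 : ℕ) : ℝ) ^ 4)) : ℝ)) : ℂ) * X) := by
    simp only [basePoly, pow_comp, add_comp, one_comp, X_comp]
    simp [sub_eq_add_neg]
  rw [this, comp_C_mul_X_coeff, coeff_one_add_X_pow]
  push_cast
  ring

/-- The coefficients of the (alternating) hypergeometric series. -/
noncomputable def hyp (b1 b2 b3 : ℝ) (k : ℕ) : ℝ :=
  (-1 / 64) ^ k * (1 / (k.factorial : ℝ)) * (∏ j ∈ Finset.range k, (b1 + j)⁻¹) *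
    (∏ j ∈ Finset.range k, (b2 + j)⁻¹) * (∏ j ∈ Finset.range k, (b3 + j)⁻¹)

lemma hyp_logDeriv_nonneg {b1 b2 b3 : ℝ} (h1 : 0 < b1) (h2 : 0 < b2) (h3 : 0 < b3)
    (T : PowerSeries ℝ) (hT : T * PowerSeries.mk (hyp b1 b2 b3) =
      - PowerSeries.derivative ℝ (PowerSeries.mk (hyp b1 b2 b3))) (n : ℕ) :
    0 ≤ PowerSeries.coeff n T := by
  set P : ℕ → ℂ[X] := fun N => thetaIter b3 (thetaIter b2 (thetaIter b1 (basePoly N) (N+1))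
    (N+1)) (N+1) with hP
  have hpos : ∀ N, PosRooted (P N) := fun N =>
    thetaIter_posRooted h3 (thetaIter_posRooted h2 (thetaIter_posRooted h1
      (basePoly_posRooted N) _) _) _
  choose S hS hSP using fun N => (hpos N).logDeriv
  have hlim := tendsto_logDeriv (fun N => (P N : PowerSeries ℂ)) S
    (PowerSeries.map Complex.ofRealHom (PowerSeries.mk (hyp b1 b2 b3)))
    (PowerSeries.map Complex.ofRealHom T) ?_ ?_ ?_ hSP ?_ n
  · have := ge_of_tendsto' hlim (fun N => hS N n)
    simpa using this
  · intro k
    have hl := ((((tendsto_const_nhds (x := ((-1/64 : ℝ))^k)).mul (tendsto_choose k)).mul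
      (tendsto_mult (b := b1) k)).mul (tendsto_mult (b := b2) k)).mul (tendsto_mult (b := b3) k)
    have hl' := (Complex.continuous_ofReal.tendsto _).comp hl
    have e : PowerSeries.coeff k (PowerSeries.map Complex.ofRealHom
        (PowerSeries.mk (hyp b1 b2 b3))) = ((hyp b1 b2 b3 k : ℝ) : ℂ) := by simp
    rw [e]
    refine hl'.congr fun N => ?_
    simp only [Function.comp, Polynomial.coeff_coe, hP]
    rw [thetaIter_coeff h3, thetaIter_coeff h2, thetaIter_coeff h1, basePoly_coeff]
    simp only [← Complex.ofReal_mul]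
    congr 1
    have : ((N + 1 : ℕ) : ℝ) ≠ 0 := by positivity
    have e2 : (- (1 / (64 * ((N + 1 : ℕ) : ℝ) ^ 4))) ^ k =
      (-1/64) ^ k / ((((N + 1 : ℕ) : ℝ) ^ k) * (((N + 1 : ℕ) : ℝ) ^ k) * (((N + 1 : ℕ) : ℝ) ^ k) *
        (((N + 1 : ℕ) : ℝ) ^ k)) := by
      rw [← mul_pow, ← mul_pow, ← mul_pow, ← div_pow]
      congr 1
      field_simp
    rw [e2]
    field_simp
  · intro N
    simp only [Polynomial.coeff_coe, hP]
    rw [thetaIter_coeff h3, thetaIter_coeff h2, thetaIter_coeff h1, basePoly_coeff]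
    simp
  · simp [hyp]
  · rw [← map_mul, hT]
    ext k
    simp [PowerSeries.coeff_derivative]
end Algebra

section Analysis
open Filter Topology

lemma exists_fps_iteratedDeriv {f : ℝ → ℝ} {p : FormalMultilinearSeries ℝ ℝ ℝ} {x : ℝ} {r : ENNReal}
    (h : HasFPowerSeriesOnBall f p x r) (m : ℕ) :
    ∃ q : FormalMultilinearSeries ℝ ℝ ℝ, HasFPowerSeriesOnBall (iteratedDeriv m f) q x r := by
  induction m with
  | zero => exact ⟨p, by simpa using h⟩
  | succ m ih =>
    obtain ⟨q, hq⟩ := ih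
    rw [iteratedDeriv_succ]
    exact ⟨_, (ContinuousLinearMap.apply ℝ ℝ (1:ℝ)).comp_hasFPowerSeriesOnBall hq.fderiv⟩

lemma iteratedDeriv_iteratedDeriv (f : ℝ → ℝ) (m n : ℕ) :
    iteratedDeriv n (iteratedDeriv m f) = iteratedDeriv (n + m) f := by
  simp only [iteratedDeriv_eq_iterate, Function.iterate_add_apply]

lemma nonneg_right {f : ℝ → ℝ} {x : ℝ} (hf : AnalyticAt ℝ f x)
    (hx : ∀ n, 0 ≤ iteratedDeriv n f x) :
    {y | ∀ n, 0 ≤ iteratedDeriv n f y} ∈ 𝓝[>] x := by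
  obtain ⟨p, r, hp⟩ := hf
  have hball : Metric.eball x r ∈ 𝓝 x := Metric.eball_mem_nhds x hp.r_pos
  filter_upwards [mem_nhdsWithin_of_mem_nhds hball, self_mem_nhdsWithin] with y hy hxy m
  obtain ⟨q, hq⟩ := exists_fps_iteratedDeriv hp m
  have hy' : y - x ∈ Metric.eball (0:ℝ) r := by
    rw [Metric.mem_eball] at hy ⊢
    rwa [edist_zero_right, ← edist_eq_enorm_sub]
  have hs := hq.hasSum_iteratedFDeriv hy'
  rw [add_sub_cancel] at hs
  refine hs.nonneg fun n => ?_
  rw [iteratedFDeriv_apply_eq_iteratedDeriv_mul_prod, iteratedDeriv_iteratedDeriv]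
  have h1 : 0 ≤ y - x := sub_nonneg.2 (le_of_lt hxy)
  have h2 := hx (n + m)
  simp only [smul_eq_mul, Finset.prod_const]
  positivity

lemma nonneg_Ico {f : ℝ → ℝ} {b : ℝ} (hf : ∀ x ∈ Ico 0 b, AnalyticAt ℝ f x)
    (h0 : ∀ n, 0 ≤ iteratedDeriv n f 0) {x : ℝ} (hx : x ∈ Ico 0 b) (n : ℕ) :
    0 ≤ iteratedDeriv n f x := by
  have han : ∀ n, ∀ x ∈ Ico 0 b, AnalyticAt ℝ (iteratedDeriv n f) x := by
    intro n x hx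
    obtain ⟨p, r, hp⟩ := hf x hx
    obtain ⟨q, hq⟩ := exists_fps_iteratedDeriv hp n
    exact hq.analyticAt
  have hsub : Icc 0 x ⊆ Ico 0 b := fun y hy => ⟨hy.1, hy.2.trans_lt hx.2⟩
  have key : Icc 0 x ⊆ {y | ∀ n, 0 ≤ iteratedDeriv n f y} := by
    refine IsClosed.Icc_subset_of_forall_mem_nhdsWithin ?_ h0 ?_
    · have : {y | ∀ n, 0 ≤ iteratedDeriv n f y} ∩ Icc 0 x =
          ⋂ n, (Icc 0 x ∩ iteratedDeriv n f ⁻¹' (Ici 0)) := by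
        ext y
        simp only [mem_inter_iff, mem_ofPred_eq, mem_iInter, mem_preimage, mem_Ici]
        exact ⟨fun h n => ⟨h.2, h.1 n⟩, fun h => ⟨fun n => (h n).2, (h 0).1⟩⟩
      rw [this]
      refine isClosed_iInter fun n => ?_
      refine ContinuousOn.preimage_isClosed_of_isClosed ?_ isClosed_Icc isClosed_Ici
      exact fun y hy => (han n y (hsub hy)).continuousAt.continuousWithinAt
    · intro y hy
      exact nonneg_right (hf y (hsub ⟨hy.2.1, hy.2.2.le⟩)) hy.1
  exact key ⟨hx.1, le_rfl⟩ n

/-- Taylor series of the (negated) logarithmic derivative. -/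
lemma taylor_logDeriv {g : ℝ → ℝ} {c : ℕ → ℝ} (hg : AnalyticAt ℝ g 0) (hg0 : g 0 ≠ 0)
    (hc : ∀ n, iteratedDeriv n g 0 = n.factorial * c n) :
    PowerSeries.mk (fun n => iteratedDeriv n (fun x => -(deriv g x / g x)) 0 / n.factorial) *
      PowerSeries.mk c = - PowerSeries.derivative ℝ (PowerSeries.mk c) := by
  set h : ℝ → ℝ := fun x => -(deriv g x / g x) with hh
  have hh_an : AnalyticAt ℝ h 0 := (hg.deriv.div hg hg0).neg
  ext n
  rw [PowerSeries.coeff_mul, map_neg, PowerSeries.coeff_derivative]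
  simp only [PowerSeries.coeff_mk]
  rw [Finset.Nat.sum_antidiagonal_eq_sum_range_succ
    (fun i j => iteratedDeriv i h 0 / (i.factorial : ℝ) * c j)]
  have e1 : (h * g) =ᶠ[𝓝 0] fun x => -(deriv g x) := by
    filter_upwards [hg.continuousAt.eventually_ne hg0] with x hx
    simp only [Pi.mul_apply, hh]
    field_simp
  have e2 := e1.iteratedDeriv_eq n
  rw [iteratedDeriv_mul hh_an.contDiffAt hg.contDiffAt, iteratedDeriv_fun_neg,
    ← iteratedDeriv_succ', hc] at e2
  have hn : (n.factorial : ℝ) ≠ 0 := by positivity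
  apply mul_left_cancel₀ hn
  rw [Nat.factorial_succ] at e2
  push_cast at e2
  have : (n.factorial : ℝ) * -(c (n+1) * (n+1)) = -((n+1) * n.factorial * c (n+1)) := by ring
  rw [this, ← e2, Finset.mul_sum]
  refine Finset.sum_congr rfl fun i hi => ?_
  have hi' : i ≤ n := Nat.lt_succ_iff.1 (Finset.mem_range.1 hi)
  rw [hc, ← Nat.choose_mul_factorial_mul_factorial hi']
  push_cast
  field_simp

/-- reciprocal -/
lemma nonneg_inv {g : ℝ → ℝ} {s : Set ℝ} (hs : IsOpen s) (hg : ∀ x ∈ s, AnalyticAt ℝ g x)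
    (hpos : ∀ x ∈ s, 0 < g x)
    (hh : ∀ n, ∀ x ∈ s, 0 ≤ iteratedDeriv n (fun x => -(deriv g x / g x)) x) (n : ℕ) :
    ∀ x ∈ s, 0 ≤ iteratedDeriv n (fun x => 1 / g x) x := by
  induction n using Nat.strong_induction_on with
  | _ n ih =>
    intro x hx
    cases n with
    | zero => simpa using (hpos x hx).le
    | succ n =>
      have e : deriv (fun x => 1 / g x) =ᶠ[𝓝 x]
          (fun x => -(deriv g x / g x)) * (fun x => 1 / g x) := by
        filter_upwards [hs.mem_nhds hx] with y hy
        have hne := (hpos y hy).ne'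
        have := ((hg y hy).differentiableAt.hasDerivAt.fun_inv hne).deriv
        simp only [one_div, Pi.mul_apply]
        rw [this]
        field_simp
      rw [iteratedDeriv_succ', e.iteratedDeriv_eq n]
      have hne := (hpos x hx).ne'
      have a1 : AnalyticAt ℝ (fun x => 1 / g x) x := analyticAt_const.div (hg x hx) hne
      have a2 : AnalyticAt ℝ (fun x => -(deriv g x / g x)) x :=
        ((hg x hx).deriv.div (hg x hx) hne).neg
      rw [iteratedDeriv_mul a2.contDiffAt a1.contDiffAt]
      refine Finset.sum_nonneg fun i _ => ?_
      have h1 := hh i x hx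
      have h2 := ih (n - i) (by omega) x hx
      positivity

end Analysis

section Final
open Filter Topology

lemma hyp_succ {b1 b2 b3 : ℝ} (k : ℕ) : hyp b1 b2 b3 (k + 1) =
    hyp b1 b2 b3 k * (-1 / 64 * (1 / ((k : ℝ) + 1)) * (b1 + k)⁻¹ * (b2 + k)⁻¹ * (b3 + k)⁻¹) := by
  simp only [hyp, Finset.prod_range_succ, Nat.factorial_succ, pow_succ]
  push_cast
  rw [one_div, mul_inv]
  ring

lemma hyp_ne_zero {b1 b2 b3 : ℝ} (h1 : 0 < b1) (h2 : 0 < b2) (h3 : 0 < b3) (k : ℕ) :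
    hyp b1 b2 b3 k ≠ 0 := by
  induction k with
  | zero => simp [hyp]
  | succ k ih =>
    rw [hyp_succ]
    refine mul_ne_zero ih ?_
    have : (0:ℝ) < (1 / 64 * (1 / ((k : ℝ) + 1)) * (b1 + k)⁻¹ * (b2 + k)⁻¹ * (b3 + k)⁻¹) := by
      positivity
    intro h
    have h' : -(1 / 64 * (1 / ((k : ℝ) + 1)) * (b1 + k)⁻¹ * (b2 + k)⁻¹ * (b3 + k)⁻¹) = 0 := by
      rw [← h]; ring
    linarith

lemma hyp_radius {b1 b2 b3 : ℝ} (h1 : 0 < b1) (h2 : 0 < b2) (h3 : 0 < b3) :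
    (FormalMultilinearSeries.ofScalars ℝ (hyp b1 b2 b3)).radius = ⊤ := by
  refine FormalMultilinearSeries.ofScalars_radius_eq_top_of_tendsto ℝ _
    (Eventually.of_forall (hyp_ne_zero h1 h2 h3)) ?_
  have hl : ∀ b : ℝ, Tendsto (fun k : ℕ => (b + k)⁻¹) atTop (𝓝 0) := fun b =>
    tendsto_inv_atTop_zero.comp (tendsto_atTop_add_const_left _ _ tendsto_natCast_atTop_atTop)
  have ht := ((((tendsto_const_nhds (x := (-1 / 64 : ℝ))).mul
    (tendsto_one_div_add_atTop_nhds_zero_nat (𝕜 := ℝ))).mul (hl b1)).mul (hl b2)).mul (hl b3)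
  have ht' := ht.norm
  simp only [mul_zero, norm_zero] at ht'
  refine ht'.congr fun k => ?_
  have := norm_ne_zero_iff.2 (hyp_ne_zero h1 h2 h3 k)
  rw [Nat.succ_eq_add_one, hyp_succ, norm_mul (hyp b1 b2 b3 k), mul_div_cancel_left₀ _ this]

/-- `𝒲_ν(t^{1/4})` as a power series in `t`. -/
noncomputable def gW (ν : ℝ) : ℝ → ℝ :=
  FormalMultilinearSeries.ofScalarsSum (E := ℝ) (hyp (ν + 1) (ν / 2 + 1) (ν / 2 + 3 / 2))

lemma gW_fps {ν : ℝ} (hν : -1 < ν) : HasFPowerSeriesOnBall (gW ν)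
    (FormalMultilinearSeries.ofScalars ℝ (hyp (ν + 1) (ν / 2 + 1) (ν / 2 + 3 / 2))) 0 ⊤ := by
  have hr := hyp_radius (b1 := ν + 1) (b2 := ν / 2 + 1) (b3 := ν / 2 + 3 / 2)
    (by linarith) (by linarith) (by linarith)
  have := (FormalMultilinearSeries.ofScalars ℝ
    (hyp (ν + 1) (ν / 2 + 1) (ν / 2 + 3 / 2))).hasFPowerSeriesOnBall (by rw [hr]; simp)
  rw [hr] at this
  exact this

lemma coeff_eq {ν : ℝ} (hν : -1 < ν) (n : ℕ) :
    (-1 : ℝ) ^ n * (Real.Gamma (ν + 1) * Real.Gamma (ν + 2)) /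
    ((2 : ℝ) ^ (4 * n) * (n.factorial : ℝ) * Real.Gamma (ν + n + 1) * Real.Gamma (ν + 2 * n + 2))
     = hyp (ν + 1) (ν / 2 + 1) (ν / 2 + 3 / 2) n := by
  have g1 : Real.Gamma (ν + 1) ≠ 0 := (Real.Gamma_pos_of_pos (by linarith)).ne'
  have g2 : Real.Gamma (ν + 2) ≠ 0 := (Real.Gamma_pos_of_pos (by linarith)).ne'
  induction n with
  | zero => simp [hyp, g1, g2]
  | succ n ih =>
    rw [hyp_succ, ← ih]
    have hn : (0:ℝ) ≤ n := Nat.cast_nonneg n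
    have p1 : ν + n + 1 ≠ 0 := by linarith
    have p2 : ν + 2 * n + 2 ≠ 0 := by linarith
    have p3 : ν + 2 * n + 3 ≠ 0 := by linarith
    have p4 : (n:ℝ) + 1 ≠ 0 := by linarith
    have e1 : Real.Gamma (ν + ((n + 1 : ℕ) : ℝ) + 1) =
        (ν + n + 1) * Real.Gamma (ν + n + 1) := by
      rw [← Real.Gamma_add_one p1]; push_cast; ring_nf
    have e2 : Real.Gamma (ν + 2 * ((n + 1 : ℕ) : ℝ) + 2) =
        (ν + 2 * n + 3) * ((ν + 2 * n + 2) * Real.Gamma (ν + 2 * n + 2)) := by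
      rw [← Real.Gamma_add_one p2, show ν + 2 * (n:ℝ) + 2 + 1 = ν + 2 * n + 3 by ring,
        ← Real.Gamma_add_one p3]; push_cast; ring_nf
    have g3 : Real.Gamma (ν + n + 1) ≠ 0 := (Real.Gamma_pos_of_pos (by linarith)).ne'
    have g4 : Real.Gamma (ν + 2 * n + 2) ≠ 0 := (Real.Gamma_pos_of_pos (by linarith)).ne'
    have f1 : (ν + 1 + (n:ℝ))⁻¹ = (ν + n + 1)⁻¹ := by ring_nf
    have f2 : (ν / 2 + 1 + (n:ℝ))⁻¹ = 2 * (ν + 2 * n + 2)⁻¹ := by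
      rw [show ν / 2 + 1 + (n:ℝ) = (ν + 2 * n + 2) / 2 by ring, inv_div, div_eq_mul_inv]
    have f3 : (ν / 2 + 3 / 2 + (n:ℝ))⁻¹ = 2 * (ν + 2 * n + 3)⁻¹ := by
      rw [show ν / 2 + 3 / 2 + (n:ℝ) = (ν + 2 * n + 3) / 2 by ring, inv_div, div_eq_mul_inv]
    rw [e1, e2, f1, f2, f3, Nat.factorial_succ, show 4 * (n + 1) = 4 * n + 4 by ring, pow_add,
      pow_succ]
    push_cast
    have : (n.factorial : ℝ) ≠ 0 := by positivity
    field_simp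
    rw [pow_add]
    ring

lemma Wcal_eq_s4 {ν : ℝ} (hν : -1 < ν) (x : ℝ) : Wcal ν x = gW ν (x ^ 4) := by
  rw [gW, FormalMultilinearSeries.ofScalarsSum_eq_tsum, Wcal]
  refine tsum_congr fun n => ?_
  rw [← coeff_eq hν, smul_eq_mul, pow_mul x 4 n]
  ring

end Final

/-- The functions `x ↦ -(log 𝒲_ν(x^{1/4}))'` and `x ↦ 1/𝒲_ν(x^{1/4})` are absolutely
monotonic on `(0, γ_{ν,1}⁴)`. -/
theorem Wcal_absolutely_monotonic (ν : ℝ) (hν : -1 < ν) (γ1 : ℝ)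
    (hγ1pos : 0 < γ1) (hγ1zero : Wcal ν γ1 = 0)
    (hγ1min : ∀ x : ℝ, 0 < x → Wcal ν x = 0 → γ1 ≤ x) :
    AbsolutelyMonotonicOn
      (fun x : ℝ => -(deriv (fun t : ℝ => Real.log (Wcal ν (t ^ (1/4 : ℝ)))) x))
      (Set.Ioo 0 (γ1 ^ 4)) ∧
    AbsolutelyMonotonicOn
      (fun x : ℝ => 1 / Wcal ν (x ^ (1/4 : ℝ)))
      (Set.Ioo 0 (γ1 ^ 4)) := by
  set g := gW ν with hg
  set b := γ1 ^ 4 with hb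
  have hfps := gW_fps hν
  have hgan : ∀ x, AnalyticAt ℝ g x := fun x => hfps.analyticAt_of_mem (by simp)
  have hgc : Continuous g := continuous_iff_continuousAt.2 fun x => (hgan x).continuousAt
  have hcoef : ∀ n : ℕ, iteratedDeriv n g 0 =
      n.factorial * hyp (ν + 1) (ν / 2 + 1) (ν / 2 + 3 / 2) n := by
    intro n
    have := hfps.factorial_smul 1 n
    rw [iteratedFDeriv_apply_eq_iteratedDeriv_mul_prod] at this
    simpa [FormalMultilinearSeries.ofScalars_apply_eq] using this.symm
  have hg0 : g 0 = 1 := by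
    have := hcoef 0
    simpa [hyp] using this
  have hroot : ∀ t : ℝ, 0 ≤ t → (t ^ (1/4 : ℝ)) ^ 4 = t := by
    intro t ht
    rw [← Real.rpow_natCast, ← Real.rpow_mul ht]
    norm_num
  have hWg : ∀ t : ℝ, 0 ≤ t → Wcal ν (t ^ (1/4 : ℝ)) = g t := by
    intro t ht
    rw [Wcal_eq_s4 hν, hroot t ht]
  have hgne : ∀ t ∈ Ico 0 b, g t ≠ 0 := by
    intro t ht h0
    rcases eq_or_lt_of_le ht.1 with h | h
    · rw [← h, hg0] at h0
      exact one_ne_zero h0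
    · have hp := Real.rpow_pos_of_pos h (1/4 : ℝ)
      have h1 := hγ1min (t ^ (1/4 : ℝ)) hp (by rw [hWg t ht.1, h0])
      have h2 : b ≤ (t ^ (1/4 : ℝ)) ^ 4 := pow_le_pow_left₀ hγ1pos.le h1 4
      rw [hroot t ht.1] at h2
      exact absurd ht.2 (not_lt.2 h2)
  have hgpos : ∀ t ∈ Ico 0 b, 0 < g t := by
    intro t ht
    by_contra hneg
    have hle : g t ≤ 0 := not_lt.1 hneg
    obtain ⟨u, hu, hu0⟩ := intermediate_value_Icc' ht.1 hgc.continuousOn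
      (show (0:ℝ) ∈ Icc (g t) (g 0) from ⟨hle, by rw [hg0]; exact zero_le_one⟩)
    exact hgne u ⟨hu.1, hu.2.trans_lt ht.2⟩ hu0
  set h : ℝ → ℝ := fun x => -(deriv g x / g x) with hh
  have hhan : ∀ x ∈ Ico 0 b, AnalyticAt ℝ h x := fun x hx =>
    ((hgan x).deriv.div (hgan x) (hgne x hx)).neg
  have hT := taylor_logDeriv (hgan 0) (by rw [hg0]; exact one_ne_zero) hcoef
  have hh0 : ∀ n, 0 ≤ iteratedDeriv n h 0 := by
    intro n
    have := hyp_logDeriv_nonneg (by linarith) (by linarith) (by linarith) _ hT n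
    rw [PowerSeries.coeff_mk] at this
    have hn : (0:ℝ) < n.factorial := by positivity
    have h2 := mul_nonneg this hn.le
    rwa [div_mul_cancel₀ _ hn.ne'] at h2
  have hsub : Ioo 0 b ⊆ Ico 0 b := Ioo_subset_Ico_self
  have hhn : ∀ n, ∀ x ∈ Ioo 0 b, 0 ≤ iteratedDeriv n h x := fun n x hx =>
    nonneg_Ico hhan hh0 (hsub hx) n
  have hinv := nonneg_inv isOpen_Ioo (fun x _ => hgan x) (fun x hx => hgpos x (hsub hx)) hhn
  have gen : ∀ f F : ℝ → ℝ, EqOn f F (Ioo 0 b) → (∀ x ∈ Ioo 0 b, AnalyticAt ℝ F x) →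
      (∀ n, ∀ x ∈ Ioo 0 b, 0 ≤ iteratedDeriv n F x) → AbsolutelyMonotonicOn f (Ioo 0 b) := by
    intro f F hfF hF hn
    refine ⟨ContDiffOn.congr (fun x hx => (hF x hx).contDiffAt.contDiffWithinAt) hfF, ?_⟩
    intro k x hx
    rw [iteratedDerivWithin_congr hfF hx, iteratedDerivWithin_of_isOpen isOpen_Ioo hx]
    exact hn k x hx
  constructor
  · refine gen _ h ?_ (fun x hx => hhan x (hsub hx)) hhn
    intro x hx
    have e : (fun t : ℝ => Real.log (Wcal ν (t ^ (1/4 : ℝ)))) =ᶠ[nhds x]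
        fun t => Real.log (g t) := by
      filter_upwards [isOpen_Ioo.mem_nhds hx] with t ht
      rw [hWg t ht.1.le]
    simp only [hh]
    rw [e.deriv_eq, ((hgan x).differentiableAt.hasDerivAt.log (hgne x (hsub hx))).deriv]
  · refine gen _ (fun x => 1 / g x) ?_
      (fun x hx => analyticAt_const.div (hgan x) (hgne x (hsub hx))) hinv
    intro x hx
    simp only
    rw [hWg x hx.1.le]
end

section
/- Let ν > -1. For every n ≥ 1 the zeros of the Dini function and of the cross-product of Bessel functions interlace: α_{ν,n} < γ_{ν,n} < α_{ν,n+1}. -/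
open Real Set

namespace DiniAux

open PowerSeries Filter Topology

/-- Power series with infinite radius of convergence. -/
def Ent (p : PowerSeries ℝ) : Prop := ∀ t : ℝ, Summable fun k => ‖coeff k p * t ^ k‖

/-- Evaluation of a power series. -/
noncomputable def ev (p : PowerSeries ℝ) (t : ℝ) : ℝ := ∑' k, coeff k p * t ^ k

lemma mul_term (p q : PowerSeries ℝ) (t : ℝ) (n : ℕ) :
    ∑ kl ∈ Finset.HasAntidiagonal.antidiagonal n, (coeff kl.1 p * t ^ kl.1) * (coeff kl.2 q * t ^ kl.2)
      = coeff n (p * q) * t ^ n := by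
  rw [coeff_mul, Finset.sum_mul]
  refine Finset.sum_congr rfl fun kl h => ?_
  rw [← Finset.HasAntidiagonal.mem_antidiagonal.1 h, pow_add]
  ring

lemma Ent.mul {p q : PowerSeries ℝ} (hp : Ent p) (hq : Ent q) : Ent (p * q) := by
  intro t
  have := summable_norm_sum_mul_antidiagonal_of_summable_norm (hp t) (hq t)
  simpa only [mul_term] using this

lemma ev_mul {p q : PowerSeries ℝ} (hp : Ent p) (hq : Ent q) (t : ℝ) :
    ev (p * q) t = ev p t * ev q t := by
  have := tsum_mul_tsum_eq_tsum_sum_antidiagonal_of_summable_norm (hp t) (hq t)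
  simp only [mul_term] at this
  exact this.symm

lemma Ent.add {p q : PowerSeries ℝ} (hp : Ent p) (hq : Ent q) : Ent (p + q) := by
  intro t
  refine Summable.of_nonneg_of_le (fun _ => norm_nonneg _) (fun k => ?_) ((hp t).add (hq t))
  rw [map_add, add_mul]
  exact norm_add_le _ _

lemma ev_add {p q : PowerSeries ℝ} (hp : Ent p) (hq : Ent q) (t : ℝ) :
    ev (p + q) t = ev p t + ev q t := by
  unfold ev
  rw [← Summable.tsum_add (hp t).of_norm (hq t).of_norm]
  simp only [map_add, add_mul]

lemma ent_C (c : ℝ) : Ent (C c) := by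
  intro t
  refine summable_of_ne_finset_zero (s := {0}) fun k hk => ?_
  have : k ≠ 0 := by simpa using hk
  simp [coeff_C, this]

lemma ev_C (c t : ℝ) : ev (C c) t = c := by
  unfold ev
  rw [tsum_eq_single 0]
  · simp
  · intro k hk
    simp [coeff_C, hk]

lemma ent_X : Ent X := by
  intro t
  refine summable_of_ne_finset_zero (s := {1}) fun k hk => ?_
  have : k ≠ 1 := by simpa using hk
  simp [coeff_X, this]

lemma ev_X (t : ℝ) : ev X t = t := by
  unfold ev
  rw [tsum_eq_single 1]
  · simp
  · intro k hk
    simp [coeff_X, hk]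

lemma nat_mul_pow_le {R : ℝ} (hR : 0 ≤ R) (k : ℕ) : ((k : ℝ) + 1) * R ^ k ≤ (R + 1) ^ (k + 1) := by
  induction k with
  | zero => simpa using hR
  | succ k ih =>
    have h1 : R ^ (k + 1) ≤ (R + 1) ^ (k + 1) := by gcongr; linarith
    rw [pow_succ (R + 1), mul_add, mul_one]
    push_cast
    have : (k + 1 : ℝ) * R ^ k * R ≤ (R + 1) ^ (k + 1) * R := by gcongr
    rw [pow_succ R k] at *
    nlinarith

lemma Ent.deriv {p : PowerSeries ℝ} (hp : Ent p) : Ent (derivative ℝ p) := by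
  intro t
  have h := (summable_nat_add_iff 1).2 (hp (|t| + 1))
  refine Summable.of_nonneg_of_le (fun _ => norm_nonneg _) (fun k => ?_) h
  rw [coeff_derivative, norm_mul, norm_mul, norm_mul, mul_assoc]
  gcongr
  rw [norm_pow, norm_pow]
  have h1 := nat_mul_pow_le (abs_nonneg t) k
  have h2 : ‖|t| + 1‖ = |t| + 1 := by
    rw [Real.norm_eq_abs]; exact abs_of_nonneg (by positivity)
  have h3 : ‖(k : ℝ) + 1‖ = k + 1 := by
    rw [Real.norm_eq_abs]; exact abs_of_nonneg (by positivity)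
  rw [h2, h3, Real.norm_eq_abs]
  exact h1

lemma ev_hasDerivAt {p : PowerSeries ℝ} (hp : Ent p) (t : ℝ) :
    HasDerivAt (ev p) (ev (derivative ℝ p) t) t := by
  have hd := hp.deriv
  set R := |t| + 1 with hR
  have hRpos : 0 < R := by positivity
  have key := hasDerivAt_tsum_of_isPreconnected (𝕜 := ℝ) (F := ℝ)
    (u := fun k : ℕ => ‖coeff k p * ((k : ℝ) * R ^ (k - 1))‖)
    (g := fun k z => coeff k p * z ^ k)
    (g' := fun k z => coeff k p * ((k : ℝ) * z ^ (k - 1)))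
    (t := Metric.ball (0 : ℝ) R) (y₀ := 0) (y := t) ?_ Metric.isOpen_ball
    (convex_ball (0 : ℝ) R).isPreconnected ?_ ?_ (by simpa using hRpos) (hp 0).of_norm
    (by simp [hR])
  · have e : ev (derivative ℝ p) t = ∑' k : ℕ, coeff k p * ((k : ℝ) * t ^ (k - 1)) := ?_
    · rw [e]; exact key
    rw [Summable.tsum_eq_zero_add]
    · unfold ev
      simp only [coeff_derivative]
      simp [mul_assoc]
    · refine (summable_nat_add_iff 1).1 ?_
      refine (hd t).of_norm.congr fun k => ?_
      rw [coeff_derivative]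
      push_cast
      simp [mul_assoc]
  · refine (summable_nat_add_iff 1).1 ?_
    refine (hd R).congr fun k => ?_
    rw [coeff_derivative]
    push_cast
    simp [mul_assoc]
  · intro k z _
    exact (hasDerivAt_pow k z).const_mul _
  · intro k z hz
    have hz' : |z| ≤ |R| := by
      rw [abs_of_pos hRpos]
      simpa using (mem_ball_zero_iff.1 hz).le
    rw [norm_mul, norm_mul, norm_mul, norm_mul, norm_pow, norm_pow]
    gcongr
    exact hz'

end DiniAux

namespace DiniAux

open PowerSeries Filter Topology

/-- Coefficients of the normalized modified Bessel function in the variable `x ^ 2 / 4`. -/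
noncomputable def ac (ν : ℝ) (k : ℕ) : ℝ :=
  Real.Gamma (ν + 1) / ((k.factorial : ℝ) * Real.Gamma (ν + k + 1))

lemma ac_zero {ν : ℝ} (hν : -1 < ν) : ac ν 0 = 1 := by
  have : 0 < Real.Gamma (ν + 1) := Real.Gamma_pos_of_pos (by linarith)
  simp [ac, this.ne']

lemma pos_aux {ν : ℝ} (hν : -1 < ν) (k : ℕ) : 0 < ν + k + 1 := by
  have : (0 : ℝ) ≤ k := k.cast_nonneg
  linarith

lemma ac_pos {ν : ℝ} (hν : -1 < ν) (k : ℕ) : 0 < ac ν k := by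
  have h1 : 0 < Real.Gamma (ν + 1) := Real.Gamma_pos_of_pos (by linarith)
  have h2 : 0 < Real.Gamma (ν + k + 1) := Real.Gamma_pos_of_pos (pos_aux hν k)
  unfold ac
  positivity

lemma ac_succ {ν : ℝ} (hν : -1 < ν) (k : ℕ) :
    ac ν (k + 1) * ((k + 1) * (ν + k + 1)) = ac ν k := by
  have h0 := pos_aux hν k
  have h2 : 0 < Real.Gamma (ν + k + 1) := Real.Gamma_pos_of_pos h0
  have h3 : Real.Gamma (ν + ((k + 1 : ℕ) : ℝ) + 1) = (ν + k + 1) * Real.Gamma (ν + k + 1) := by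
    rw [← Real.Gamma_add_one h0.ne']
    push_cast
    ring_nf
  unfold ac
  rw [h3, Nat.factorial_succ]
  push_cast
  field_simp

/-- Formal series of the normalized modified Bessel function. -/
noncomputable def Is (ν : ℝ) : PowerSeries ℝ := PowerSeries.mk fun k => ac ν k

/-- Formal series of the normalized Bessel function. -/
noncomputable def Js (ν : ℝ) : PowerSeries ℝ := PowerSeries.mk fun k => (-1) ^ k * ac ν k

lemma ent_Is {ν : ℝ} (hν : -1 < ν) : Ent (Is ν) := by
  intro t
  refine summable_of_ratio_norm_eventually_le (r := 1 / 2) (by norm_num) ?_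
  obtain ⟨N, hN⟩ := exists_nat_gt (2 * |t| - ν)
  filter_upwards [eventually_ge_atTop N] with k hk
  have hk' : (N : ℝ) ≤ k := by exact_mod_cast hk
  have h1 := ac_pos hν (k + 1)
  have h0 := pos_aux hν k
  rw [norm_norm, norm_norm, norm_mul, norm_mul, norm_pow, norm_pow]
  simp only [Is, coeff_mk, Real.norm_eq_abs]
  rw [abs_of_pos h1, abs_of_pos (ac_pos hν k), ← ac_succ hν k, pow_succ]
  have h2 : |t| ≤ 1 / 2 * ((k + 1) * (ν + k + 1)) := by
    have : (0 : ℝ) ≤ k := k.cast_nonneg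
    nlinarith
  have h3 : 0 ≤ ac ν (k + 1) * |t| ^ k := by positivity
  nlinarith [mul_le_mul_of_nonneg_left h2 h3]

lemma ent_Js {ν : ℝ} (hν : -1 < ν) : Ent (Js ν) := by
  intro t
  refine (ent_Is hν t).congr fun k => ?_
  simp [Is, Js]

lemma coeff_X_mul_derivative (p : PowerSeries ℝ) (m : ℕ) :
    coeff m (X * derivative ℝ p) = m * coeff m p := by
  rcases m with _ | m
  · simp
  · rw [coeff_succ_X_mul, coeff_derivative]
    push_cast
    ring

lemma ode_I {ν : ℝ} (hν : -1 < ν) :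
    X * derivative ℝ (derivative ℝ (Is ν)) + C (ν + 1) * derivative ℝ (Is ν) = Is ν := by
  ext k
  have := ac_succ hν k
  rw [map_add, coeff_X_mul_derivative, coeff_C_mul, coeff_derivative]
  simp only [Is, coeff_mk]
  linarith

lemma ode_J {ν : ℝ} (hν : -1 < ν) :
    X * derivative ℝ (derivative ℝ (Js ν)) + C (ν + 1) * derivative ℝ (Js ν) = - Js ν := by
  ext k
  have := ac_succ hν k
  rw [map_add, map_neg, coeff_X_mul_derivative, coeff_C_mul, coeff_derivative]
  simp only [Js, coeff_mk]
  rw [← this]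
  ring

/-- The formal Wronskian. -/
noncomputable def Ws (ν : ℝ) : PowerSeries ℝ :=
  Js ν * derivative ℝ (Is ν) + C (-1) * (derivative ℝ (Js ν) * Is ν)

lemma ws_eq1 {ν : ℝ} (hν : -1 < ν) :
    X * derivative ℝ (Ws ν) + C (ν + 1) * Ws ν = C 2 * (Js ν * Is ν) := by
  have hI := ode_I hν
  have hJ := ode_J hν
  simp only [Ws, map_add, Derivation.leibniz, smul_eq_mul, derivative_one, map_neg, map_one, map_ofNat]
    at *
  linear_combination Js ν * hI - Is ν * hJ

lemma ws_eq2 {ν : ℝ} (hν : -1 < ν) :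
    X * derivative ℝ (derivative ℝ (Js ν * Is ν)) + C (ν + 1) * derivative ℝ (Js ν * Is ν)
      = C 2 * (X * (derivative ℝ (Js ν) * derivative ℝ (Is ν))) := by
  have hI := ode_I hν
  have hJ := ode_J hν
  simp only [Ws, map_add, Derivation.leibniz, smul_eq_mul, derivative_one, map_neg, map_one, map_ofNat]
    at *
  linear_combination Js ν * hI + Is ν * hJ

lemma ws_eq3 {ν : ℝ} (hν : -1 < ν) :
    X * derivative ℝ (derivative ℝ (Js ν) * derivative ℝ (Is ν))
      + C (2 * (ν + 1)) * (derivative ℝ (Js ν) * derivative ℝ (Is ν)) = C (-1) * Ws ν := by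
  have hI := ode_I hν
  have hJ := ode_J hν
  simp only [Ws, map_add, map_mul, Derivation.leibniz, smul_eq_mul, derivative_one, map_neg, map_one,
    map_ofNat] at *
  linear_combination derivative ℝ (Js ν) * hI + derivative ℝ (Is ν) * hJ

lemma ws_rel1 {ν : ℝ} (hν : -1 < ν) (m : ℕ) :
    (m + ν + 1) * coeff m (Ws ν) = 2 * coeff m (Js ν * Is ν) := by
  have := congrArg (coeff m) (ws_eq1 hν)
  rw [map_add, coeff_X_mul_derivative, coeff_C_mul, coeff_C_mul] at this
  linarith

lemma ws_rel3 {ν : ℝ} (hν : -1 < ν) (m : ℕ) :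
    (m + 2 * (ν + 1)) * coeff m (derivative ℝ (Js ν) * derivative ℝ (Is ν)) = - coeff m (Ws ν) := by
  have := congrArg (coeff m) (ws_eq3 hν)
  rw [map_add, coeff_X_mul_derivative, coeff_C_mul, coeff_C_mul] at this
  linarith

lemma ws_rel2_zero {ν : ℝ} (hν : -1 < ν) : coeff 1 (Js ν * Is ν) = 0 := by
  have := congrArg (coeff 0) (ws_eq2 hν)
  rw [map_add, coeff_X_mul_derivative, coeff_C_mul, coeff_C_mul, coeff_zero_X_mul,
    coeff_derivative] at this
  have h : ν + 1 ≠ 0 := by linarith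
  simpa [h] using this

lemma ws_rel2 {ν : ℝ} (hν : -1 < ν) (m : ℕ) :
    (m + 2) * (m + 2 + ν) * coeff (m + 2) (Js ν * Is ν)
      = 2 * coeff m (derivative ℝ (Js ν) * derivative ℝ (Is ν)) := by
  have := congrArg (coeff (m + 1)) (ws_eq2 hν)
  rw [map_add, coeff_X_mul_derivative, coeff_C_mul, coeff_C_mul, coeff_succ_X_mul,
    coeff_derivative] at this
  push_cast at this
  rw [← this]
  ring

lemma ws_zero {ν : ℝ} (hν : -1 < ν) : (ν + 1) * coeff 0 (Ws ν) = 2 := by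
  have h := ws_rel1 hν 0
  rw [coeff_mul] at h
  simpa [Js, Is, ac_zero hν] using h

lemma ws_odd {ν : ℝ} (hν : -1 < ν) (n : ℕ) : coeff (2 * n + 1) (Ws ν) = 0 := by
  induction n with
  | zero =>
    have h := ws_rel1 hν 1
    rw [ws_rel2_zero hν] at h
    have : ((1 : ℕ) : ℝ) + ν + 1 ≠ 0 := by push_cast; linarith
    exact (mul_eq_zero.1 (h.trans (mul_zero 2))).resolve_left this
  | succ n ih =>
    have h3 := ws_rel3 hν (2 * n + 1)
    have h2 := ws_rel2 hν (2 * n + 1)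
    have h1 := ws_rel1 hν (2 * n + 1 + 2)
    have hn : (0 : ℝ) ≤ n := n.cast_nonneg
    rw [ih, neg_zero, mul_eq_zero] at h3
    have h3' := h3.resolve_left (by push_cast; linarith)
    rw [h3', mul_zero, mul_eq_zero] at h2
    have h2' := h2.resolve_left (by push_cast; apply ne_of_gt; apply mul_pos <;> linarith)
    rw [h2', mul_zero, mul_eq_zero] at h1
    exact h1.resolve_left (by push_cast; linarith)

lemma ws_even_succ {ν : ℝ} (hν : -1 < ν) (n : ℕ) :
    (n + 1) * (ν + n + 1) * (ν + 2 * n + 2) * (ν + 2 * n + 3) * coeff (2 * (n + 1)) (Ws ν)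
      = - coeff (2 * n) (Ws ν) := by
  have h3 := ws_rel3 hν (2 * n)
  have h2 := ws_rel2 hν (2 * n)
  have h1 := ws_rel1 hν (2 * n + 2)
  rw [← h3]
  rw [show 2 * (n + 1) = 2 * n + 2 by ring]
  push_cast at *
  linear_combination (n + 1) * (ν + n + 1) * (ν + 2 * n + 2) * h1 + (ν + n + 1) * h2

lemma ws_even {ν : ℝ} (hν : -1 < ν) (n : ℕ) :
    (ν + 1) / 2 * coeff (2 * n) (Ws ν) = (-1) ^ n * (Real.Gamma (ν + 1) * Real.Gamma (ν + 2)) /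
      ((n.factorial : ℝ) * Real.Gamma (ν + n + 1) * Real.Gamma (ν + 2 * n + 2)) := by
  have g1 : 0 < Real.Gamma (ν + 1) := Real.Gamma_pos_of_pos (by linarith)
  have g2 : 0 < Real.Gamma (ν + 2) := Real.Gamma_pos_of_pos (by linarith)
  induction n with
  | zero =>
    have := ws_zero hν
    have e : (ν + 1) / 2 * coeff 0 (Ws ν) = 1 := by linarith
    rw [mul_zero, e]
    simp [g1.ne', g2.ne']
  | succ n ih =>
    have h := ws_even_succ hν n
    have hn : (0 : ℝ) ≤ n := n.cast_nonneg
    have h0 := pos_aux hν n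
    have k1 : 0 < ν + 2 * n + 2 := by linarith
    have k2 : 0 < ν + 2 * n + 3 := by linarith
    have g3 : 0 < Real.Gamma (ν + n + 1) := Real.Gamma_pos_of_pos h0
    have g4 : 0 < Real.Gamma (ν + 2 * n + 2) := Real.Gamma_pos_of_pos k1
    have e1 : Real.Gamma (ν + ((n + 1 : ℕ) : ℝ) + 1) = (ν + n + 1) * Real.Gamma (ν + n + 1) := by
      rw [← Real.Gamma_add_one h0.ne']
      push_cast
      ring_nf
    have e2 : Real.Gamma (ν + 2 * ((n + 1 : ℕ) : ℝ) + 2)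
        = (ν + 2 * n + 3) * ((ν + 2 * n + 2) * Real.Gamma (ν + 2 * n + 2)) := by
      rw [← Real.Gamma_add_one k1.ne', show ν + 2 * (n : ℝ) + 2 + 1 = ν + 2 * n + 3 by ring,
        ← Real.Gamma_add_one k2.ne']
      push_cast
      ring_nf
    have e3 : coeff (2 * (n + 1)) (Ws ν) = - coeff (2 * n) (Ws ν) /
        ((n + 1) * (ν + n + 1) * (ν + 2 * n + 2) * (ν + 2 * n + 3)) := by
      rw [eq_div_iff (by positivity), ← h]
      ring
    rw [e1, e2, e3, Nat.factorial_succ, pow_succ, mul_div_assoc', mul_neg, ih]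
    push_cast
    field_simp

lemma Wcal_eq {ν : ℝ} (hν : -1 < ν) (x : ℝ) :
    Wcal ν x = (ν + 1) / 2 * ev (Ws ν) (x ^ 2 / 4) := by
  unfold Wcal ev
  rw [← tsum_mul_left]
  have hinj : Function.Injective (fun n : ℕ => 2 * n) := fun a b h => by
    simpa using h
  rw [← hinj.tsum_eq (f := fun k => (ν + 1) / 2 * (coeff k (Ws ν) * (x ^ 2 / 4) ^ k))]
  · refine tsum_congr fun n => ?_
    have h := ws_even hν n
    rw [← mul_assoc ((ν + 1) / 2), h, div_pow, ← pow_mul, show 2 * (2 * n) = 4 * n by ring,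
      show (4 : ℝ) ^ (2 * n) = 2 ^ (4 * n) by
        rw [show (4 : ℝ) = 2 ^ 2 by norm_num, ← pow_mul]; ring_nf]
    field_simp
  · intro k hk
    rcases Nat.even_or_odd' k with ⟨n, rfl | rfl⟩
    · exact ⟨n, rfl⟩
    · simp [ws_odd hν n] at hk

lemma Dcal_eq (ν x : ℝ) :
    Dcal ν x = ev (Js ν + C 2 * (X * derivative ℝ (Js ν))) (x ^ 2 / 4) := by
  unfold Dcal ev
  refine tsum_congr fun n => ?_
  rw [map_add, coeff_C_mul, coeff_X_mul_derivative, div_pow, ← pow_mul,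
    show (4 : ℝ) ^ n = 2 ^ (2 * n) by rw [pow_mul]; norm_num]
  simp only [Js, coeff_mk, ac]
  field_simp
  ring

end DiniAux

namespace DiniAux

open Filter Topology

lemma exists_right {f : ℝ → ℝ} {f' a b : ℝ} (hf : HasDerivAt f f' a) (hf' : 0 < f') (h0 : f a = 0)
    (hab : a < b) : ∃ x ∈ Ioo a b, 0 < f x := by
  have h := eventually_nhdsWithin_sign_eq_of_deriv_pos (f := f) (x₀ := a) (by rwa [hf.deriv]) h0
  have h2 : ∀ᶠ x in 𝓝[>] a, x ∈ Ioo a b := Ioo_mem_nhdsGT hab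
  obtain ⟨x, hx, hx2⟩ := ((h.filter_mono nhdsWithin_le_nhds).and h2).exists
  refine ⟨x, hx2, ?_⟩
  rw [sign_pos (sub_pos.2 hx2.1)] at hx
  exact sign_eq_one_iff.1 hx

lemma exists_left {f : ℝ → ℝ} {f' a b : ℝ} (hf : HasDerivAt f f' b) (hf' : 0 < f') (h0 : f b = 0)
    (hab : a < b) : ∃ x ∈ Ioo a b, f x < 0 := by
  have h := eventually_nhdsWithin_sign_eq_of_deriv_pos (f := f) (x₀ := b) (by rwa [hf.deriv]) h0
  have h2 : ∀ᶠ x in 𝓝[<] b, x ∈ Ioo a b := Ioo_mem_nhdsLT hab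
  obtain ⟨x, hx, hx2⟩ := ((h.filter_mono nhdsWithin_le_nhds).and h2).exists
  refine ⟨x, hx2, ?_⟩
  rw [sign_neg (sub_neg.2 hx2.2)] at hx
  exact sign_eq_neg_one_iff.1 hx

lemma exists_zero {f : ℝ → ℝ} (hf : Continuous f) {s : Set ℝ} (hs : s.OrdConnected) {x y : ℝ}
    (hx : x ∈ s) (hy : y ∈ s) (hfx : f x ≤ 0) (hfy : 0 ≤ f y) : ∃ c ∈ s, f c = 0 := by
  have := hs.isPreconnected.intermediate_value hx hy hf.continuousOn
  obtain ⟨c, hc, h⟩ := this ⟨hfx, hfy⟩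
  exact ⟨c, hc, h⟩

lemma zero_between_pos {f f1 : ℝ → ℝ} (hf : ∀ t, HasDerivAt f (f1 t) t) {a b : ℝ} (hab : a < b)
    (ha : f a = 0) (hb : f b = 0) (h1 : 0 < f1 a) (h2 : 0 < f1 b) : ∃ c ∈ Ioo a b, f c = 0 := by
  obtain ⟨x, hx, hfx⟩ := exists_right (hf a) h1 ha hab
  obtain ⟨y, hy, hfy⟩ := exists_left (hf b) h2 hb hab
  have hc : Continuous f := continuous_iff_continuousAt.2 fun t => (hf t).continuousAt
  exact exists_zero hc ordConnected_Ioo hy hx hfy.le hfx.le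

lemma zero_between {f f1 : ℝ → ℝ} (hf : ∀ t, HasDerivAt f (f1 t) t) {a b : ℝ} (hab : a < b)
    (ha : f a = 0) (hb : f b = 0) (h : 0 < f1 a * f1 b) : ∃ c ∈ Ioo a b, f c = 0 := by
  rcases pos_and_pos_or_neg_and_neg_of_mul_pos h with ⟨h1, h2⟩ | ⟨h1, h2⟩
  · exact zero_between_pos hf hab ha hb h1 h2
  · obtain ⟨c, hc, h⟩ := zero_between_pos (f := fun t => - f t) (f1 := fun t => - f1 t)
      (fun t => (hf t).neg) hab (by simp [ha]) (by simp [hb]) (by simpa using h1) (by simpa using h2)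
    exact ⟨c, hc, by simpa using h⟩

lemma zero_or_zero {f f1 g : ℝ → ℝ} (hf : ∀ t, HasDerivAt f (f1 t) t) (hg : Continuous g) {a b : ℝ}
    (hab : a < b) (ha : f a = 0) (hb : f b = 0) (h : 0 < (g a * f1 a) * (g b * f1 b)) :
    (∃ c ∈ Ioo a b, f c = 0) ∨ ∃ c ∈ Ioo a b, g c = 0 := by
  by_cases hc : 0 < f1 a * f1 b
  · exact Or.inl (zero_between hf hab ha hb hc)
  · right
    have hgg : g a * g b < 0 := by
      by_contra hcon
      push Not at hc hcon
      nlinarith [mul_nonneg hcon (neg_nonneg.2 hc)]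
    have hga : g a ≠ 0 := by rintro h0; simp [h0] at hgg
    have hgb : g b ≠ 0 := by rintro h0; simp [h0] at hgg
    have : ∃ c ∈ Icc a b, g c = 0 := by
      rcases mul_neg_iff.1 hgg with ⟨h1, h2⟩ | ⟨h1, h2⟩
      · exact exists_zero hg ordConnected_Icc (right_mem_Icc.2 hab.le) (left_mem_Icc.2 hab.le)
          h2.le h1.le
      · exact exists_zero hg ordConnected_Icc (left_mem_Icc.2 hab.le) (right_mem_Icc.2 hab.le)
          h1.le h2.le
    obtain ⟨c, ⟨hc1, hc2⟩, h0⟩ := this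
    refine ⟨c, ⟨lt_of_le_of_ne hc1 ?_, lt_of_le_of_ne hc2 ?_⟩, h0⟩
    · rintro rfl; exact hga h0
    · rintro rfl; exact hgb h0

lemma no_zero {f : ℝ → ℝ} {a : ℕ → ℝ} (hpos : ∀ n, 1 ≤ n → 0 < a n)
    (hmono : ∀ m n, 1 ≤ m → m < n → a m < a n)
    (hall : ∀ x : ℝ, 0 < x → f x = 0 → ∃ n, 1 ≤ n ∧ x = a n) {n : ℕ} (hn : 1 ≤ n) :
    ¬ ∃ c ∈ Ioo (a n) (a (n + 1)), f c = 0 := by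
  rintro ⟨c, ⟨h1, h2⟩, h0⟩
  obtain ⟨k, hk, rfl⟩ := hall c ((hpos n hn).trans h1) h0
  rcases lt_trichotomy k n with h | h | h
  · exact (hmono k n hk h).not_gt h1
  · subst h; exact lt_irrefl _ h1
  · rcases (Nat.succ_le_of_lt h).eq_or_lt with h | h
    · subst h; exact lt_irrefl _ h2
    · exact (hmono (n + 1) k (by omega) h).not_gt h2

lemma interlace {D D1 W W1 : ℝ → ℝ} (hD : ∀ t, HasDerivAt D (D1 t) t)
    (hW : ∀ t, HasDerivAt W (W1 t) t) (hD0 : 0 < D 0) (hW0 : 0 < W 0)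
    (hA : ∀ t, 0 < t → D t = 0 → W t * D1 t < 0)
    (hB : ∀ t, 0 < t → W t = 0 → 0 < D t * W1 t) (α γ : ℕ → ℝ)
    (hαpos : ∀ n, 1 ≤ n → 0 < α n)
    (hαmono : ∀ m n, 1 ≤ m → m < n → α m < α n)
    (hαzero : ∀ n, 1 ≤ n → D (α n) = 0)
    (hαall : ∀ x : ℝ, 0 < x → D x = 0 → ∃ n, 1 ≤ n ∧ x = α n)
    (hγpos : ∀ n, 1 ≤ n → 0 < γ n)
    (hγmono : ∀ m n, 1 ≤ m → m < n → γ m < γ n)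
    (hγzero : ∀ n, 1 ≤ n → W (γ n) = 0)
    (hγall : ∀ x : ℝ, 0 < x → W x = 0 → ∃ n, 1 ≤ n ∧ x = γ n) :
    ∀ n, 1 ≤ n → α n < γ n ∧ γ n < α (n + 1) := by
  have hDc : Continuous D := continuous_iff_continuousAt.2 fun t => (hD t).continuousAt
  have hWc : Continuous W := continuous_iff_continuousAt.2 fun t => (hW t).continuousAt
  have hα' : ∀ m n, 1 ≤ m → m ≤ n → α m ≤ α n := fun m n h1 h => by
    rcases h.eq_or_lt with rfl | h
    · exact le_rfl
    · exact (hαmono m n h1 h).le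
  have hγ' : ∀ m n, 1 ≤ m → m ≤ n → γ m ≤ γ n := fun m n h1 h => by
    rcases h.eq_or_lt with rfl | h
    · exact le_rfl
    · exact (hγmono m n h1 h).le
  have s1 : ∀ n, 1 ≤ n → ∃ k, 1 ≤ k ∧ α n < γ k ∧ γ k < α (n + 1) := by
    intro n hn
    have hn' : 1 ≤ n + 1 := by omega
    rcases zero_or_zero hD hWc (hαmono n (n + 1) hn (by omega)) (hαzero n hn) (hαzero _ hn')
      (mul_pos_of_neg_of_neg (hA _ (hαpos n hn) (hαzero n hn))
        (hA _ (hαpos _ hn') (hαzero _ hn'))) with h | ⟨c, hc, h⟩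
    · exact absurd h (no_zero hαpos hαmono hαall hn)
    · obtain ⟨k, hk, rfl⟩ := hγall c ((hαpos n hn).trans hc.1) h
      exact ⟨k, hk, hc.1, hc.2⟩
  have s2 : ∀ n, 1 ≤ n → ∃ k, 1 ≤ k ∧ γ n < α k ∧ α k < γ (n + 1) := by
    intro n hn
    have hn' : 1 ≤ n + 1 := by omega
    rcases zero_or_zero hW hDc (hγmono n (n + 1) hn (by omega)) (hγzero n hn) (hγzero _ hn')
      (mul_pos (hB _ (hγpos n hn) (hγzero n hn))
        (hB _ (hγpos _ hn') (hγzero _ hn'))) with h | ⟨c, hc, h⟩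
    · exact absurd h (no_zero hγpos hγmono hγall hn)
    · obtain ⟨k, hk, rfl⟩ := hαall c ((hγpos n hn).trans hc.1) h
      exact ⟨k, hk, hc.1, hc.2⟩
  have s0 : α 1 < γ 1 := by
    by_contra! hcon
    have g1 := hγpos 1 le_rfl
    have hB1 := hB _ g1 (hγzero 1 le_rfl)
    have hDpos : 0 < D (γ 1) := by
      by_contra! hneg
      obtain ⟨c, hc, h0⟩ := exists_zero hDc (ordConnected_Icc (a := 0) (b := γ 1))
        (right_mem_Icc.2 g1.le) (left_mem_Icc.2 g1.le) hneg hD0.le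
      have hc0 : 0 < c := lt_of_le_of_ne hc.1 (by rintro rfl; exact hD0.ne' h0)
      obtain ⟨k, hk, rfl⟩ := hαall c hc0 h0
      have e : α k = γ 1 := le_antisymm hc.2 (hcon.trans (hα' 1 k le_rfl hk))
      have := hA _ hc0 h0
      rw [e, hγzero 1 le_rfl] at this
      simp at this
    have hW1 : 0 < W1 (γ 1) := pos_of_mul_pos_right hB1 hDpos.le
    obtain ⟨x, hx, hWx⟩ := exists_left (hW _) hW1 (hγzero 1 le_rfl) g1
    obtain ⟨c, hc, h0⟩ := exists_zero hWc (ordConnected_Icc (a := 0) (b := x))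
        (right_mem_Icc.2 hx.1.le) (left_mem_Icc.2 hx.1.le) hWx.le hW0.le
    have hc0 : 0 < c := lt_of_le_of_ne hc.1 (by rintro rfl; exact hW0.ne' h0)
    obtain ⟨k, hk, rfl⟩ := hγall c hc0 h0
    have := hγ' 1 k le_rfl hk
    linarith [hc.2, hx.2]
  intro n hn
  induction n, hn using Nat.le_induction with
  | base =>
    obtain ⟨k, hk, h1, h2⟩ := s1 1 le_rfl
    exact ⟨s0, (hγ' 1 k le_rfl hk).trans_lt h2⟩
  | succ n hn ih =>
    constructor
    · obtain ⟨k, hk, h1, h2⟩ := s2 n hn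
      have : n + 1 ≤ k := by
        by_contra! h
        have := hα' k n hk (by omega)
        linarith [ih.1]
      exact (hα' (n + 1) k (by omega) this).trans_lt h2
    · obtain ⟨k, hk, h1, h2⟩ := s1 (n + 1) (by omega)
      have : n + 1 ≤ k := by
        by_contra! h
        have := hγ' k n hk (by omega)
        linarith [ih.2]
      exact (hγ' (n + 1) k (by omega) this).trans_lt h2

end DiniAux

namespace DiniAux

open PowerSeries Filter Topology

lemma ev_zero (p : PowerSeries ℝ) : ev p 0 = coeff 0 p := by
  unfold ev
  rw [tsum_eq_single 0]
  · simp
  · intro k hk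
    simp [hk]

lemma ev_Is_pos {ν : ℝ} (hν : -1 < ν) {t : ℝ} (ht : 0 < t) : 0 < ev (Is ν) t := by
  refine Summable.tsum_pos (ent_Is hν t).of_norm (fun k => ?_) 0 ?_
  · have := ac_pos hν k
    simp only [Is, coeff_mk]
    positivity
  · simp [Is, ac_zero hν]

lemma ev_dIs_nonneg {ν : ℝ} (hν : -1 < ν) {t : ℝ} (ht : 0 < t) :
    0 ≤ ev (derivative ℝ (Is ν)) t := by
  refine tsum_nonneg fun k => ?_
  have := ac_pos hν (k + 1)
  rw [coeff_derivative]
  simp only [Is, coeff_mk]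
  positivity

lemma ev_Js_zero {ν : ℝ} (hν : -1 < ν) : ev (Js ν) 0 = 1 := by
  rw [ev_zero, Js, coeff_mk, ac_zero hν]; simp

lemma ev_ode_J {ν : ℝ} (hν : -1 < ν) (t : ℝ) :
    t * ev (derivative ℝ (derivative ℝ (Js ν))) t + (ν + 1) * ev (derivative ℝ (Js ν)) t
      = - ev (Js ν) t := by
  have h := congrArg (fun p => ev p t) (ode_J hν)
  have hJ := ent_Js hν
  have e : - Js ν = C (-1) * Js ν := by simp
  rw [e, ev_add (ent_X.mul hJ.deriv.deriv) ((ent_C _).mul hJ.deriv), ev_mul ent_X hJ.deriv.deriv,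
    ev_mul (ent_C _) hJ.deriv, ev_mul (ent_C _) hJ, ev_X, ev_C, ev_C] at h
  linarith

lemma ent_Ws {ν : ℝ} (hν : -1 < ν) : Ent (Ws ν) :=
  ((ent_Js hν).mul (ent_Is hν).deriv).add ((ent_C _).mul ((ent_Js hν).deriv.mul (ent_Is hν)))

lemma ev_Ws {ν : ℝ} (hν : -1 < ν) (t : ℝ) :
    ev (Ws ν) t = ev (Js ν) t * ev (derivative ℝ (Is ν)) t
      - ev (derivative ℝ (Js ν)) t * ev (Is ν) t := by
  have hJ := ent_Js hν
  have hI := ent_Is hν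
  rw [Ws, ev_add (hJ.mul hI.deriv) ((ent_C _).mul (hJ.deriv.mul hI)), ev_mul hJ hI.deriv,
    ev_mul (ent_C _) (hJ.deriv.mul hI), ev_mul hJ.deriv hI, ev_C]
  ring

lemma ev_Ws_ode {ν : ℝ} (hν : -1 < ν) (t : ℝ) :
    t * ev (derivative ℝ (Ws ν)) t + (ν + 1) * ev (Ws ν) t = 2 * (ev (Js ν) t * ev (Is ν) t) := by
  have hJ := ent_Js hν
  have hI := ent_Is hν
  have hW := ent_Ws hν
  have h := congrArg (fun p => ev p t) (ws_eq1 hν)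
  rwa [ev_add (ent_X.mul hW.deriv) ((ent_C _).mul hW), ev_mul ent_X hW.deriv,
    ev_mul (ent_C _) hW, ev_mul (ent_C _) (hJ.mul hI), ev_mul hJ hI, ev_X, ev_C, ev_C] at h

/-- The formal Dini series. -/
noncomputable def Ds (ν : ℝ) : PowerSeries ℝ := Js ν + C 2 * (X * derivative ℝ (Js ν))

lemma ev_Ds {ν : ℝ} (hν : -1 < ν) (t : ℝ) :
    ev (Ds ν) t = ev (Js ν) t + 2 * (t * ev (derivative ℝ (Js ν)) t) := by
  have hJ := ent_Js hν
  rw [Ds, ev_add hJ ((ent_C _).mul (ent_X.mul hJ.deriv)), ev_mul (ent_C _) (ent_X.mul hJ.deriv),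
    ev_mul ent_X hJ.deriv, ev_C, ev_X]

lemma Ds_hasDerivAt {ν : ℝ} (hν : -1 < ν) (t : ℝ) :
    HasDerivAt (ev (Ds ν)) ((1 - 2 * ν) * ev (derivative ℝ (Js ν)) t - 2 * ev (Js ν) t) t := by
  have hJ := ent_Js hν
  have h := (ev_hasDerivAt hJ t).add
    (((hasDerivAt_id t).mul (ev_hasDerivAt hJ.deriv t)).const_mul 2)
  have e : ev (Ds ν) = ev (Js ν) + fun s => 2 * (((id : ℝ → ℝ) * ev (derivative ℝ (Js ν))) s) := by
    funext s
    simp [ev_Ds hν s]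
  rw [e]
  refine h.congr_deriv ?_
  have := ev_ode_J hν t
  simp only [id]
  linear_combination 2 * this

/-- The Lommel type energy. -/
noncomputable def en (ν t : ℝ) : ℝ :=
  t * ev (derivative ℝ (Js ν)) t ^ 2 + ν * (ev (Js ν) t * ev (derivative ℝ (Js ν)) t)
    + ev (Js ν) t ^ 2

lemma en_hasDerivAt {ν : ℝ} (hν : -1 < ν) (t : ℝ) : ∃ e',
    HasDerivAt (en ν) e' t ∧ (ν + 1) * en ν t + t * e' = ev (Js ν) t ^ 2 := by
  have hJ := ent_Js hν
  have h0 := ev_hasDerivAt hJ t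
  have h1 := ev_hasDerivAt hJ.deriv t
  have h := (((hasDerivAt_id t).mul (h1.pow 2)).add ((h0.mul h1).const_mul ν)).add (h0.pow 2)
  refine ⟨_, h, ?_⟩
  have := ev_ode_J hν t
  simp only [id, en]
  simp
  linear_combination (2 * t * ev (derivative ℝ (Js ν)) t + ν * ev (Js ν) t) * this

lemma en_zero {ν : ℝ} (hν : -1 < ν) : 0 < en ν 0 := by
  obtain ⟨e', -, h⟩ := en_hasDerivAt hν 0
  rw [ev_Js_zero hν] at h
  have : 0 < ν + 1 := by linarith
  have h2 : (ν + 1) * en ν 0 = 1 := by linarith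
  by_contra! hc
  nlinarith

lemma en_pos {ν : ℝ} (hν : -1 < ν) {t : ℝ} (ht : 0 < t) : 0 < en ν t := by
  have hd : ∀ s : ℝ, 0 < s →
      HasDerivAt (fun s => s ^ (ν + 1) * en ν s) (s ^ ν * ev (Js ν) s ^ 2) s := by
    intro s hs
    obtain ⟨e', he, h⟩ := en_hasDerivAt hν s
    refine ((Real.hasDerivAt_rpow_const (p := ν + 1) (Or.inl hs.ne')).mul he).congr_deriv ?_
    rw [← h, Real.rpow_add_one hs.ne', add_sub_cancel_right]
    ring
  have hm : MonotoneOn (fun s => s ^ (ν + 1) * en ν s) (Ioi 0) := by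
    refine monotoneOn_of_deriv_nonneg (convex_Ioi 0)
      (fun s hs => (hd s hs).continuousAt.continuousWithinAt)
      (fun s hs => (hd s (by simpa using hs)).differentiableAt.differentiableWithinAt)
      (fun s hs => ?_)
    have hs' : 0 < s := by simpa using hs
    rw [(hd s hs').deriv]
    positivity
  obtain ⟨e', he, -⟩ := en_hasDerivAt hν 0
  have h1 : ∀ᶠ s in 𝓝[>] (0 : ℝ), 0 < en ν s :=
    (he.continuousAt.eventually (lt_mem_nhds (en_zero hν))).filter_mono nhdsWithin_le_nhds
  have h2 : ∀ᶠ s in 𝓝[>] (0 : ℝ), s ∈ Ioo 0 t := Ioo_mem_nhdsGT ht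
  obtain ⟨s, hs1, hs2⟩ := (h1.and h2).exists
  have h3 := hm (a := s) (b := t) hs2.1 ht hs2.2.le
  have h4 : 0 < s ^ (ν + 1) * en ν s := mul_pos (Real.rpow_pos_of_pos hs2.1 _) hs1
  exact pos_of_mul_pos_right (h4.trans_le h3) (Real.rpow_pos_of_pos ht _).le

lemma sign_A {ν : ℝ} (hν : -1 < ν) (t : ℝ) (ht : 0 < t) (h : ev (Ds ν) t = 0) :
    ev (Ws ν) t * ((1 - 2 * ν) * ev (derivative ℝ (Js ν)) t - 2 * ev (Js ν) t) < 0 := by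
  rw [ev_Ds hν] at h
  rw [ev_Ws hν]
  have he := en_pos hν ht
  unfold en at he
  have hi := ev_Is_pos hν ht
  have hi1 := ev_dIs_nonneg hν ht
  set j := ev (Js ν) t
  set j1 := ev (derivative ℝ (Js ν)) t
  set i := ev (Is ν) t
  set i1 := ev (derivative ℝ (Is ν)) t
  have hj : j = -2 * t * j1 := by linarith
  rw [hj] at he ⊢
  have h1 : 0 < t * (j1 ^ 2 * (1 - 2 * ν + 4 * t)) := by linarith
  have h2 : 0 < j1 ^ 2 * (1 - 2 * ν + 4 * t) := pos_of_mul_pos_right h1 ht.le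
  have h3 : 0 < 2 * t * i1 + i := by positivity
  have := mul_pos h2 h3
  linarith

lemma sign_B {ν : ℝ} (hν : -1 < ν) (t : ℝ) (ht : 0 < t) (h : ev (Ws ν) t = 0) :
    0 < ev (Ds ν) t * ev (derivative ℝ (Ws ν)) t := by
  have hw := ev_Ws_ode hν t
  rw [h] at hw
  rw [ev_Ws hν] at h
  rw [ev_Ds hν]
  have he := en_pos hν ht
  unfold en at he
  have hi := ev_Is_pos hν ht
  have hi1 := ev_dIs_nonneg hν ht
  set j := ev (Js ν) t
  set j1 := ev (derivative ℝ (Js ν)) t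
  set i := ev (Is ν) t
  set i1 := ev (derivative ℝ (Is ν)) t
  set w1 := ev (derivative ℝ (Ws ν)) t
  have hj : j ≠ 0 := by
    intro h0
    have : j1 = 0 := by
      have : j1 * i = 0 := by rw [h0] at h; linarith
      exact (mul_eq_zero.1 this).resolve_right hi.ne'
    rw [h0, this] at he
    simp at he
  have h3 : 0 < i + 2 * t * i1 := by positivity
  have hj2 : 0 < j ^ 2 := by positivity
  have key : (t * i) * ((j + 2 * (t * j1)) * w1) = 2 * i * j ^ 2 * (i + 2 * t * i1) := by
    linear_combination i * (j + 2 * (t * j1)) * hw - 4 * t * i * j * h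
  have : 0 < (t * i) * ((j + 2 * (t * j1)) * w1) := by rw [key]; positivity
  exact pos_of_mul_pos_right this (by positivity)

end DiniAux

/-- Interlacing of the zeros of the Dini function and of the cross-product of Bessel
functions: `α_{ν,n} < γ_{ν,n} < α_{ν,n+1}` for every `n ≥ 1`. -/
theorem dini_crossW_zeros_interlace (ν : ℝ) (hν : -1 < ν) (α γ : ℕ → ℝ)
    (hαpos : ∀ n, 1 ≤ n → 0 < α n)
    (hαmono : ∀ m n, 1 ≤ m → m < n → α m < α n)
    (hαzero : ∀ n, 1 ≤ n → Dcal ν (α n) = 0)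
    (hαall : ∀ x : ℝ, 0 < x → Dcal ν x = 0 → ∃ n, 1 ≤ n ∧ x = α n)
    (hγpos : ∀ n, 1 ≤ n → 0 < γ n)
    (hγmono : ∀ m n, 1 ≤ m → m < n → γ m < γ n)
    (hγzero : ∀ n, 1 ≤ n → Wcal ν (γ n) = 0)
    (hγall : ∀ x : ℝ, 0 < x → Wcal ν x = 0 → ∃ n, 1 ≤ n ∧ x = γ n) :
    ∀ n, 1 ≤ n → α n < γ n ∧ γ n < α (n + 1) := by
  have hν1 : 0 < ν + 1 := by linarith
  have hDz : ∀ x, Dcal ν x = 0 ↔ DiniAux.ev (DiniAux.Ds ν) (x ^ 2 / 4) = 0 := fun x => by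
    rw [DiniAux.Dcal_eq]; rfl
  have hWz : ∀ x, Wcal ν x = 0 ↔ DiniAux.ev (DiniAux.Ws ν) (x ^ 2 / 4) = 0 := fun x => by
    rw [DiniAux.Wcal_eq hν]
    have : (ν + 1) / 2 ≠ 0 := by positivity
    simp [this]
  have hsq : ∀ t : ℝ, 0 < t → 0 < 2 * √t ∧ (2 * √t) ^ 2 / 4 = t := fun t ht => by
    refine ⟨by positivity, ?_⟩
    rw [mul_pow, Real.sq_sqrt ht.le]
    ring
  have hD0 : 0 < DiniAux.ev (DiniAux.Ds ν) 0 := by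
    rw [DiniAux.ev_Ds hν, DiniAux.ev_Js_zero hν]
    simp
  have hW0 : 0 < DiniAux.ev (DiniAux.Ws ν) 0 := by
    rw [DiniAux.ev_zero]
    have := DiniAux.ws_zero hν
    exact pos_of_mul_pos_right (this ▸ (by norm_num : (0 : ℝ) < 2)) hν1.le
  have key := DiniAux.interlace (DiniAux.Ds_hasDerivAt hν)
    (DiniAux.ev_hasDerivAt (DiniAux.ent_Ws hν)) hD0 hW0 (DiniAux.sign_A hν) (DiniAux.sign_B hν)
    (fun n => α n ^ 2 / 4) (fun n => γ n ^ 2 / 4)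
    (fun n hn => by have := hαpos n hn; positivity)
    (fun m n hm h => by
      have h1 := hαpos m hm
      have h2 := hαmono m n hm h
      gcongr)
    (fun n hn => (hDz _).1 (hαzero n hn))
    (fun t ht h => by
      obtain ⟨h1, h2⟩ := hsq t ht
      rw [← h2] at h
      obtain ⟨n, hn, e⟩ := hαall _ h1 ((hDz _).2 h)
      exact ⟨n, hn, by simp only [← e, h2]⟩)
    (fun n hn => by have := hγpos n hn; positivity)
    (fun m n hm h => by
      have h1 := hγpos m hm
      have h2 := hγmono m n hm h
      gcongr)
    (fun n hn => (hWz _).1 (hγzero n hn))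
    (fun t ht h => by
      obtain ⟨h1, h2⟩ := hsq t ht
      rw [← h2] at h
      obtain ⟨n, hn, e⟩ := hγall _ h1 ((hWz _).2 h)
      exact ⟨n, hn, by simp only [← e, h2]⟩)
  intro n hn
  obtain ⟨h1, h2⟩ := key n hn
  have p1 := hαpos n hn
  have p2 := hγpos n hn
  have p3 := hαpos (n + 1) (by omega)
  constructor
  · exact lt_of_pow_lt_pow_left₀ 2 p2.le (by linarith)
  · exact lt_of_pow_lt_pow_left₀ 2 p3.le (by linarith)
end
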